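/- Let N be an odd positive integer, 𝔞 ∈ 𝔈₂, and α an element of the upper half-plane that is imaginary quadratic, i.e. [ℚ(α):ℚ] = 2. Then W_𝔞(α) is an algebraic unit: both W_𝔞(α) and W_𝔞(α)⁻¹ are integral over ℤ. -/

import Mathlib

open scoped MatrixGroups
open Complex

/-- The Weierstrass ℘-function of the lattice `L_τ = ℤ + ℤτ`. -/
noncomputable def wp (τ z : ℂ) : ℂ :=
  1 / z ^ 2 + ∑' p : {p : ℤ × ℤ // p ≠ 0},
    (1 / (z - ((p.1.1 : ℂ) + (p.1.2 : ℂ) * τ)) ^ 2 - 1 / ((p.1.1 : ℂ) + (p.1.2 : ℂ) * τ) ^ 2)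

/-- The function `W_𝔞` for the triple `𝔞 = [a₁,a₂,a₃]`. -/
noncomputable def Wfun (N : ℕ) (a₁ a₂ a₃ : ℤ) (τ : ℂ) : ℂ :=
  (wp τ ((a₁ : ℂ) / N) - wp τ ((a₃ : ℂ) / N)) / (wp τ ((a₂ : ℂ) / N) - wp τ ((a₃ : ℂ) / N))

/-- Möbius action of an integral 2×2 matrix on ℂ. -/
noncomputable def moebius (A : Matrix (Fin 2) (Fin 2) ℤ) (τ : ℂ) : ℂ :=
  ((A 0 0 : ℂ) * τ + (A 0 1 : ℂ)) / ((A 1 0 : ℂ) * τ + (A 1 1 : ℂ))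

/-- `𝔖_N = (ℤ/Nℤ)ˣ/{±1}`. -/
abbrev SNgroup (N : ℕ) := (ZMod N)ˣ ⧸ (Subgroup.closure ({-1} : Set (ZMod N)ˣ))

/-- The triple `𝔞 = [a₁,a₂,a₃]` is in `𝔈`. -/
def memE (N : ℕ) (a : ℤ × ℤ × ℤ) : Prop :=
  0 < a.1 ∧ 0 < a.2.1 ∧ 0 < a.2.2 ∧ 2 * a.1 ≤ (N : ℤ) ∧ 2 * a.2.1 ≤ (N : ℤ) ∧
    2 * a.2.2 ≤ (N : ℤ) ∧ a.1 ≠ a.2.1 ∧ a.1 ≠ a.2.2 ∧ a.2.1 ≠ a.2.2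

def memE1 (N : ℕ) (a : ℤ × ℤ × ℤ) : Prop :=
  memE N a ∧ IsCoprime (a.1 * a.2.1 * a.2.2) (N : ℤ)

def memE2 (N : ℕ) (a : ℤ × ℤ × ℤ) : Prop :=
  memE1 N a ∧ IsCoprime (a.1 - a.2.2) (N : ℤ) ∧ IsCoprime (a.1 + a.2.2) (N : ℤ) ∧
    IsCoprime (a.2.1 - a.2.2) (N : ℤ) ∧ IsCoprime (a.2.1 + a.2.2) (N : ℤ)

/-- `M` is a lift to `Γ₀(N)` of `diag(λ⁻¹, λ)` for the class `s = λ ∈ 𝔖_N`. -/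
def IsDiagLift (N : ℕ) (M : SL(2, ℤ)) (s : SNgroup N) : Prop :=
  ∃ u : (ZMod N)ˣ, (QuotientGroup.mk u : SNgroup N) = s ∧
    ((M 0 0 : ℤ) : ZMod N) = ((u⁻¹ : (ZMod N)ˣ) : ZMod N) ∧
    ((M 0 1 : ℤ) : ZMod N) = 0 ∧ ((M 1 0 : ℤ) : ZMod N) = 0 ∧
    ((M 1 1 : ℤ) : ZMod N) = (u : ZMod N)

/-- The function `T_{𝔄,F}`. -/
noncomputable def Tfun (N : ℕ) {n : ℕ} (A : Fin n → ℤ × ℤ × ℤ)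
    (F : MvPolynomial (Fin n) ℤ) (M : SNgroup N → SL(2, ℤ)) (τ : ℂ) : ℂ :=
  ∑ᶠ s : SNgroup N, MvPolynomial.aeval
    (fun i => Wfun N (A i).1 (A i).2.1 (A i).2.2 (moebius ((M s : SL(2, ℤ)) : Matrix (Fin 2) (Fin 2) ℤ) τ)) F

/-- The matrix `B(t,u,v,k)`. -/
def Bmat (t : ℕ) (u v k : ℤ) : Matrix (Fin 2) (Fin 2) ℤ :=
  !![u, (u * v - 1) / (t : ℤ) + u * k; (t : ℤ), v + (t : ℤ) * k]

/-- `{a}` : the representative of `±a mod N` in `(0, N/2]` (paper's `{·}`). -/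
def red (N : ℕ) (a : ℤ) : ℤ :=
  if 2 * (a % (N : ℤ)) ≤ (N : ℤ) then a % (N : ℤ) else (N : ℤ) - a % (N : ℤ)

/-- `μ(a) ∈ {±1}` with `a ≡ μ(a){a} mod N`. -/
def muSign (N : ℕ) (a : ℤ) : ℤ :=
  if 2 * (a % (N : ℤ)) ≤ (N : ℤ) then 1 else -1

/-- `φ_s(τ) = (2πi)⁻²℘(s/N; L_τ) − 1/12`. -/
noncomputable def phiFun (N : ℕ) (s : ℤ) (τ : ℂ) : ℂ :=
  (1 / (2 * (Real.pi : ℂ) * Complex.I) ^ 2) * wp τ ((s : ℂ) / N) - 1 / 12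

/-- `f[A]₂` : weight-2 slash of `φ_s`. -/
noncomputable def phiSlash (N : ℕ) (s : ℤ) (A : Matrix (Fin 2) (Fin 2) ℤ) (τ : ℂ) : ℂ :=
  phiFun N s (moebius A τ) * ((A 1 0 : ℂ) * τ + (A 1 1 : ℂ)) ^ (-2 : ℤ)

/-- `q = e^{2πiτ/N}`. -/
noncomputable def qq (N : ℕ) (τ : ℂ) : ℂ :=
  Complex.exp (2 * (Real.pi : ℂ) * Complex.I * τ / N)

/-- `ζ = e^{2πi/N}`. -/
noncomputable def zetaN (N : ℕ) : ℂ :=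
  Complex.exp (2 * (Real.pi : ℂ) * Complex.I / N)

/-- `θ_{a,b} = ζ^a(1−ζ^{b−a})(1−ζ^{b+a})/((1−ζ^a)²(1−ζ^b)²)`. -/
noncomputable def theta (ζ : ℂ) (a b : ℤ) : ℂ :=
  ζ ^ a * (1 - ζ ^ (b - a)) * (1 - ζ ^ (b + a)) / ((1 - ζ ^ a) ^ 2 * (1 - ζ ^ b) ^ 2)

open scoped PowerSeries in
/-- A power series with algebraic integer coefficients that converges on the open unit disc. -/
structure PowerSeries.IsAdmissible (P : ℂ⟦X⟧) : Prop where
  integral : ∀ n, IsIntegral ℤ (PowerSeries.coeff n P)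
  summable : ∀ x : ℂ, ‖x‖ < 1 → Summable fun n ↦ PowerSeries.coeff n P * x ^ n

namespace PowerSeries

/-- The sum of a power series at a point. -/
noncomputable def sumAt (P : ℂ⟦X⟧) (x : ℂ) : ℂ := ∑' n, coeff n P * x ^ n

lemma sumAt_zero (P : ℂ⟦X⟧) : P.sumAt 0 = coeff 0 P := by
  rw [sumAt, tsum_eq_single 0 (by intro n hn; simp [hn])]
  simp

lemma hasFPowerSeriesOnBall_sumAt {P : ℂ⟦X⟧}
    (hP : ∀ x : ℂ, ‖x‖ < 1 → Summable fun n ↦ coeff n P * x ^ n) :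
    HasFPowerSeriesOnBall P.sumAt (.ofScalars ℂ fun n ↦ coeff n P) 0 1 := by
  constructor
  · refine le_of_forall_lt_imp_le_of_dense fun r hr ↦ ?_
    lift r to NNReal using hr.ne_top
    apply FormalMultilinearSeries.le_radius_of_summable
    simpa [smul_eq_mul, norm_mul, mul_comm, mul_left_comm, mul_assoc] using
      (hP r (by simpa using hr)).norm
  · simp
  · intro y hy
    rw [← ENNReal.coe_one, Metric.eball_coe, NNReal.coe_one, mem_ball_zero_iff] at hy
    simpa [mul_comm, sumAt] using (hP y hy).hasSum

lemma eq_of_sumAt_eventuallyEq {P Q : ℂ⟦X⟧}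
    (hP : ∀ x : ℂ, ‖x‖ < 1 → Summable fun n ↦ coeff n P * x ^ n)
    (hQ : ∀ x : ℂ, ‖x‖ < 1 → Summable fun n ↦ coeff n Q * x ^ n)
    (h : P.sumAt =ᶠ[nhds 0] Q.sumAt) : P = Q := by
  have h1 := (hasFPowerSeriesOnBall_sumAt hP).hasFPowerSeriesAt
  have h2 := (hasFPowerSeriesOnBall_sumAt hQ).hasFPowerSeriesAt
  have := h1.eq_formalMultilinearSeries (h2.congr h.symm)
  ext n
  simpa using congrArg (fun p ↦ p.coeff n) this

lemma summable_mul {P Q : ℂ⟦X⟧} {x : ℂ} (hP : Summable fun n ↦ coeff n P * x ^ n)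
    (hQ : Summable fun n ↦ coeff n Q * x ^ n) :
    Summable (fun n ↦ coeff n (P * Q) * x ^ n) ∧ (P * Q).sumAt x = P.sumAt x * Q.sumAt x := by
  have key : ∀ n, coeff n (P * Q) * x ^ n =
      ∑ kl ∈ Finset.HasAntidiagonal.antidiagonal n, (coeff kl.1 P * x ^ kl.1) * (coeff kl.2 Q * x ^ kl.2) := by
    intro n
    rw [coeff_mul, Finset.sum_mul]
    refine Finset.sum_congr rfl fun kl hkl ↦ ?_
    rw [← Finset.HasAntidiagonal.mem_antidiagonal.mp hkl, pow_add]
    ring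
  refine ⟨?_, ?_⟩
  · simp_rw [key]
    exact summable_norm_sum_mul_antidiagonal_of_summable_norm hP.norm hQ.norm |>.of_norm
  · simp_rw [sumAt, key]
    exact (tsum_mul_tsum_eq_tsum_sum_antidiagonal_of_summable_norm hP.norm hQ.norm).symm

namespace IsAdmissible

variable {P Q : ℂ⟦X⟧}

lemma add (hP : P.IsAdmissible) (hQ : Q.IsAdmissible) : (P + Q).IsAdmissible where
  integral n := by simpa using (hP.integral n).add (hQ.integral n)
  summable x hx := by simpa [add_mul] using (hP.summable x hx).add (hQ.summable x hx)

lemma sumAt_add (hP : P.IsAdmissible) (hQ : Q.IsAdmissible) {x : ℂ} (hx : ‖x‖ < 1) :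
    (P + Q).sumAt x = P.sumAt x + Q.sumAt x := by
  simpa [add_mul, sumAt] using (hP.summable x hx).tsum_add (hQ.summable x hx)

lemma mul (hP : P.IsAdmissible) (hQ : Q.IsAdmissible) : (P * Q).IsAdmissible where
  integral n := by
    rw [coeff_mul]
    exact IsIntegral.sum _ fun kl _ ↦ (hP.integral _).mul (hQ.integral _)
  summable x hx := (summable_mul (hP.summable x hx) (hQ.summable x hx)).1

lemma sumAt_mul (hP : P.IsAdmissible) (hQ : Q.IsAdmissible) {x : ℂ} (hx : ‖x‖ < 1) :
    (P * Q).sumAt x = P.sumAt x * Q.sumAt x :=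
  (summable_mul (hP.summable x hx) (hQ.summable x hx)).2

lemma X_pow (k : ℕ) : (X ^ k : ℂ⟦X⟧).IsAdmissible where
  integral n := by
    rw [coeff_X_pow]
    split_ifs
    exacts [isIntegral_one, isIntegral_zero]
  summable x hx := by
    refine summable_of_ne_finset_zero (s := {k}) fun n hn ↦ ?_
    rw [coeff_X_pow, if_neg (by simpa using hn), zero_mul]

lemma C {c : ℂ} (hc : IsIntegral ℤ c) : (PowerSeries.C c : ℂ⟦X⟧).IsAdmissible where
  integral n := by
    rw [coeff_C]
    split_ifs
    exacts [hc, isIntegral_zero]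
  summable x hx := by
    refine summable_of_ne_finset_zero (s := {0}) fun n hn ↦ ?_
    rw [coeff_C, if_neg (by simpa using hn), zero_mul]

/-- The series obtained by removing the first `k` coefficients. -/
lemma shift (hP : P.IsAdmissible) (k : ℕ) :
    (PowerSeries.mk fun n ↦ coeff (n + k) P).IsAdmissible where
  integral n := by simpa using hP.integral (n + k)
  summable x hx := by
    rcases eq_or_ne x 0 with rfl | h0
    · refine summable_of_ne_finset_zero (s := {0}) fun n hn ↦ ?_
      simp [Finset.notMem_singleton.mp hn]
    · refine (((summable_nat_add_iff k).mpr (hP.summable x hx)).mul_right (x ^ k)⁻¹).congr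
        fun n ↦ ?_
      rw [coeff_mk, pow_add]
      field_simp

lemma continuousAt_sumAt (hP : P.IsAdmissible) : ContinuousAt P.sumAt 0 :=
  (hasFPowerSeriesOnBall_sumAt hP.summable).hasFPowerSeriesAt.continuousAt

lemma differentiableOn_sumAt (hP : P.IsAdmissible) :
    DifferentiableOn ℂ P.sumAt (Metric.ball 0 1) := by
  have := (hasFPowerSeriesOnBall_sumAt hP.summable).differentiableOn
  rwa [← ENNReal.coe_one, Metric.eball_coe, NNReal.coe_one] at this

/-- The inverse of a nowhere vanishing admissible series with unit constant term. -/
lemma inv (hP : P.IsAdmissible) (h0 : IsIntegral ℤ (coeff 0 P)⁻¹)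
    (hne : ∀ x : ℂ, ‖x‖ < 1 → P.sumAt x ≠ 0) :
    (P⁻¹).IsAdmissible := by
  have hc0 : constantCoeff P ≠ 0 := by
    have := hne 0 (by simp)
    rwa [sumAt_zero, coeff_zero_eq_constantCoeff_apply] at this
  refine ⟨fun n ↦ ?_, ?_⟩
  · induction n using Nat.strong_induction_on with
    | _ n ih =>
      rw [PowerSeries.coeff_inv]
      rw [coeff_zero_eq_constantCoeff_apply] at h0
      split_ifs with hn
      · exact h0
      · refine h0.neg.mul (IsIntegral.sum _ fun x hx ↦ ?_)
        split_ifs with h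
        · exact (hP.integral _).mul (ih _ h)
        · exact isIntegral_zero
  · have hd : DifferentiableOn ℂ (fun x ↦ (P.sumAt x)⁻¹) (Metric.ball 0 1) :=
      hP.differentiableOn_sumAt.inv fun x hx ↦ hne x (by simpa using hx)
    set B : ℂ⟦X⟧ := PowerSeries.mk fun n ↦
      (n.factorial : ℂ)⁻¹ * iteratedDeriv n (fun x ↦ (P.sumAt x)⁻¹) 0
    have hB : ∀ x : ℂ, ‖x‖ < 1 → HasSum (fun n ↦ coeff n B * x ^ n) (P.sumAt x)⁻¹ := by
      intro x hx
      have := Complex.hasSum_taylorSeries_on_ball hd (z := x) (by simpa using hx)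
      simpa [B, mul_comm, mul_left_comm, mul_assoc] using this
    have h1 : P * B = 1 := by
      refine eq_of_sumAt_eventuallyEq
        (fun x hx ↦ (summable_mul (hP.summable x hx) (hB x hx).summable).1)
        (fun x hx ↦ by simpa using (X_pow 0).summable x hx) ?_
      filter_upwards [Metric.ball_mem_nhds (0 : ℂ) one_pos] with x hx
      have hx : ‖x‖ < 1 := by simpa using hx
      rw [(summable_mul (hP.summable x hx) (hB x hx).summable).2, sumAt, sumAt, (hB x hx).tsum_eq,
        ← sumAt, mul_inv_cancel₀ (hne x hx), sumAt, tsum_eq_single 0]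
      · simp
      · intro n hn
        simp [coeff_one, hn]
    have h2 : B = P⁻¹ := by
      rw [PowerSeries.eq_inv_iff_mul_eq_one hc0, mul_comm, h1]
    intro x hx
    rw [← h2]
    exact (hB x hx).summable

lemma sumAt_inv (hP : P.IsAdmissible) (hQ : (P⁻¹).IsAdmissible) (h0 : coeff 0 P ≠ 0) {x : ℂ}
    (hx : ‖x‖ < 1) : (P⁻¹).sumAt x = (P.sumAt x)⁻¹ := by
  refine eq_inv_of_mul_eq_one_right ?_
  rw [← hP.sumAt_mul hQ hx, PowerSeries.mul_inv_cancel _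
    (by rwa [coeff_zero_eq_constantCoeff_apply] at h0), sumAt, tsum_eq_single 0]
  · simp
  · intro n hn
    simp [coeff_one, hn]

/-- Substitution of `ζ X ^ a` for `X`. -/
lemma exists_subst (hP : P.IsAdmissible) {ζ : ℂ} (hζ : IsIntegral ℤ ζ) (hζ1 : ‖ζ‖ = 1) {a : ℕ}
    (ha : 0 < a) : ∃ Q : ℂ⟦X⟧, Q.IsAdmissible ∧ coeff 0 Q = coeff 0 P ∧
      ∀ x : ℂ, ‖x‖ < 1 → Q.sumAt x = P.sumAt (ζ * x ^ a) := by
  set Q : ℂ⟦X⟧ := PowerSeries.mk fun n ↦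
    if a ∣ n then coeff (n / a) P * ζ ^ (n / a) else 0 with hQ
  have hinj : Function.Injective fun n : ℕ ↦ a * n := fun m n h ↦ Nat.eq_of_mul_eq_mul_left ha h
  have key : ∀ x : ℂ, ‖x‖ < 1 → HasSum (fun n ↦ coeff n Q * x ^ n) (P.sumAt (ζ * x ^ a)) := by
    intro x hx
    rw [← hinj.hasSum_iff]
    · have hx' : ‖ζ * x ^ a‖ < 1 := by
        rw [norm_mul, hζ1, one_mul, norm_pow]
        exact pow_lt_one₀ (norm_nonneg _) hx ha.ne'
      refine ((hP.summable _ hx').hasSum).congr_fun ?_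
      intro n
      simp [Q, Nat.mul_div_cancel_left n ha, mul_pow, pow_mul, mul_assoc]
    · intro n hn
      have : ¬ a ∣ n := fun ⟨m, hm⟩ ↦ hn ⟨m, hm.symm⟩
      simp [Q, this]
  refine ⟨Q, ⟨fun n ↦ ?_, fun x hx ↦ (key x hx).summable⟩, by simp [Q], fun x hx ↦ (key x hx).tsum_eq⟩
  simp only [Q, coeff_mk]
  split_ifs
  · exact (hP.integral _).mul (hζ.pow _)
  · exact isIntegral_zero

/-- Infinite products `∏ (1 + c i * X ^ e i)` with rapidly growing exponents. -/
lemma exists_tprod {c : ℕ → ℂ} {e : ℕ → ℕ} (hc : ∀ i, IsIntegral ℤ (c i)) (hc1 : ∀ i, ‖c i‖ ≤ 1)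
    (he : ∀ i, i < e i) : ∃ Q : ℂ⟦X⟧, Q.IsAdmissible ∧ coeff 0 Q = 1 ∧
      ∀ x : ℂ, ‖x‖ < 1 → Q.sumAt x = ∏' i, (1 + c i * x ^ e i) := by
  have hfin (n : ℕ) (s : Finset ℕ) (hs : ∑ i ∈ s, e i = n) : s ⊆ Finset.range n := by
    intro i hi
    have : e i ≤ ∑ i ∈ s, e i := Finset.single_le_sum (f := e) (fun _ _ ↦ Nat.zero_le _) hi
    have := he i
    simp only [Finset.mem_range]
    omega
  set Q : ℂ⟦X⟧ := PowerSeries.mk fun n ↦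
    ∑ s ∈ (Finset.range n).powerset with ∑ i ∈ s, e i = n, ∏ i ∈ s, c i with hQ
  have hsum : ∀ x : ℂ, ‖x‖ < 1 → Summable fun i ↦ ‖c i * x ^ e i‖ := by
    intro x hx
    refine Summable.of_nonneg_of_le (fun _ ↦ norm_nonneg _) (fun i ↦ ?_)
      (summable_geometric_of_lt_one (norm_nonneg x) hx)
    rw [norm_mul, norm_pow]
    exact (mul_le_of_le_one_left (by positivity) (hc1 i)).trans
      (pow_le_pow_of_le_one (norm_nonneg _) hx.le (he i).le)
  have key : ∀ x : ℂ, ‖x‖ < 1 →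
      HasSum (fun n ↦ coeff n Q * x ^ n) (∏' i, (1 + c i * x ^ e i)) := by
    intro x hx
    have h1 := summable_finsetProd_of_summable_norm (hsum x hx)
    rw [tprod_one_add h1]
    have h2 := (Equiv.sigmaFiberEquiv fun s : Finset ℕ ↦ ∑ i ∈ s, e i).hasSum_iff.mpr h1.hasSum
    refine h2.sigma fun n ↦ ?_
    have h3 : coeff n Q * x ^ n = ∑ s ∈ (Finset.range n).powerset with ∑ i ∈ s, e i = n,
        ∏ i ∈ s, (c i * x ^ e i) := by
      simp only [Q, coeff_mk, Finset.sum_mul]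
      refine Finset.sum_congr rfl fun s hs ↦ ?_
      rw [Finset.prod_mul_distrib, Finset.prod_pow_eq_pow_sum, (Finset.mem_filter.mp hs).2]
    rw [h3]
    have h4 : (Function.support fun s : Finset ℕ ↦
        if ∑ i ∈ s, e i = n then ∏ i ∈ s, (c i * x ^ e i) else 0) ⊆
        ↑((Finset.range n).powerset.filter fun s ↦ ∑ i ∈ s, e i = n) := by
      intro s hs
      have h5 : ∑ i ∈ s, e i = n := by
        by_contra h
        simp [h] at hs
      simp [h5, hfin n s h5]
    have h6 := hasSum_sum_of_ne_finset_zero (f := fun s : Finset ℕ ↦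
        if ∑ i ∈ s, e i = n then ∏ i ∈ s, (c i * x ^ e i) else 0) (L := .unconditional _)
        (s := (Finset.range n).powerset.filter fun s ↦ ∑ i ∈ s, e i = n)
        (fun s hs ↦ Function.notMem_support.mp fun h ↦ hs (h4 h))
    rw [Finset.sum_congr rfl (g := fun s ↦ ∏ i ∈ s, (c i * x ^ e i))
      (fun s hs ↦ if_pos (Finset.mem_filter.mp hs).2)] at h6
    have h7 : Set.indicator {s : Finset ℕ | ∑ i ∈ s, e i = n} (fun s ↦ ∏ i ∈ s, (c i * x ^ e i)) =
        fun s : Finset ℕ ↦ if ∑ i ∈ s, e i = n then ∏ i ∈ s, (c i * x ^ e i) else 0 := by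
      ext s
      simp [Set.indicator_apply]
    rw [← h7] at h6
    exact (hasSum_subtype_iff_indicator.mpr h6)
  refine ⟨Q, ⟨fun n ↦ ?_, fun x hx ↦ (key x hx).summable⟩, ?_, fun x hx ↦ (key x hx).tsum_eq⟩
  · simp only [Q, coeff_mk]
    exact IsIntegral.sum _ fun s _ ↦ IsIntegral.prod _ fun i _ ↦ hc i
  · simp [Q, Finset.filter_singleton]

end IsAdmissible

end PowerSeries

namespace PeriodPair

open Filter Topology

variable (L : PeriodPair)

/-- An entire function which is constant along the lattice is constant. -/
lemma exists_const_of_periodic {H : ℂ → ℂ} (hd : Differentiable ℂ H)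
    (hp : ∀ l ∈ L.lattice, H.Periodic l) : ∃ c, ∀ z, H z = c := by
  refine hd.exists_const_forall_eq_of_bounded ?_
  have hK : IsCompact (closure (ZSpan.fundamentalDomain L.basis)) :=
    (ZSpan.fundamentalDomain_isBounded L.basis).isCompact_closure
  refine (hK.image hd.continuous).isBounded.subset ?_
  rintro _ ⟨z, rfl⟩
  refine ⟨ZSpan.fract L.basis z, subset_closure (ZSpan.fract_mem_fundamentalDomain L.basis z), ?_⟩
  refine (hp (ZSpan.floor L.basis z) ?_).sub_eq z
  rw [lattice_eq_span_range_basis]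
  exact (ZSpan.floor L.basis z).2

/-- A meromorphic function without poles which is constant along the lattice agrees with a
constant up to removable singularities. -/
lemma exists_const_eventuallyEq {h : ℂ → ℂ} (hm : Meromorphic h)
    (ho : ∀ z, 0 ≤ meromorphicOrderAt h z) (hp : ∀ l ∈ L.lattice, h.Periodic l) :
    ∃ c, ∀ z, h =ᶠ[𝓝[≠] z] fun _ ↦ c := by
  have hm' : MeromorphicOn h Set.univ := fun z _ ↦ hm z
  set H := toMeromorphicNFOn h Set.univ with hH
  have hHh : ∀ z, H =ᶠ[𝓝[≠] z] h := fun z ↦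
    hm'.toMeromorphicNFOn_eq_self_on_nhdsNE (Set.mem_univ z)
  have ha : ∀ z, AnalyticAt ℂ H z := fun z ↦ by
    rw [← (meromorphicNFOn_toMeromorphicNFOn h Set.univ
      (Set.mem_univ z)).meromorphicOrderAt_nonneg_iff_analyticAt,
      meromorphicOrderAt_toMeromorphicNFOn hm' (Set.mem_univ z)]
    exact ho z
  obtain ⟨c, hc⟩ := L.exists_const_of_periodic (fun z ↦ (ha z).differentiableAt) fun l hl z ↦ by
    have h1 : (fun z ↦ H (z + l)) =ᶠ[𝓝[≠] z] fun z ↦ h (z + l) := by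
      have ht : Tendsto (fun z ↦ z + l) (𝓝[≠] z) (𝓝[≠] (z + l)) :=
        tendsto_nhdsWithin_of_tendsto_nhds_of_eventually_within _
          ((continuous_add_const l).continuousAt.mono_left nhdsWithin_le_nhds)
          (eventually_nhdsWithin_of_forall fun y hy ↦ by simpa using hy)
      exact ht.eventually (hHh (z + l))
    have h2 : (fun z ↦ H (z + l)) =ᶠ[𝓝[≠] z] H := by
      filter_upwards [h1, hHh z] with y hy1 hy2
      rw [hy1, hy2, hp l hl]
    have hc1 : ContinuousAt (fun z ↦ H (z + l)) z :=
      ContinuousAt.comp (g := H) (ha _).continuousAt (continuous_add_const l).continuousAt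
    exact tendsto_nhds_unique (hc1.tendsto.mono_left nhdsWithin_le_nhds)
      (((ha z).continuousAt.tendsto.mono_left nhdsWithin_le_nhds).congr' h2.symm)
  refine ⟨c, fun z ↦ ?_⟩
  filter_upwards [hHh z] with y hy
  rw [← hy, hc]

/-- Entire functions with simple zeros exactly at the points of the lattice and with
factors of automorphy like those of the Weierstrass `σ`-function. -/
structure IsTheta (Θ : ℂ → ℂ) : Prop where
  differentiable : Differentiable ℂ Θ
  eq_zero_iff (z : ℂ) : Θ z = 0 ↔ z ∈ L.lattice
  deriv_ne_zero : ∀ z ∈ L.lattice, deriv Θ z ≠ 0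
  exists_factor : ∀ l ∈ ({L.ω₁, L.ω₂} : Set ℂ), ∃ ε : ℂ → ℂ, (∀ z, ε z ≠ 0) ∧
    (∀ z, Θ (z + l) = ε z * Θ z) ∧ ∀ z w, ε (z + w) * ε (z - w) = ε z ^ 2

namespace IsTheta

variable {L} {Θ : ℂ → ℂ} (hΘ : L.IsTheta Θ)
include hΘ

lemma analyticAt (z : ℂ) : AnalyticAt ℂ Θ z := hΘ.differentiable.analyticAt z

lemma meromorphicOrderAt_of_mem {z : ℂ} (hz : z ∈ L.lattice) : meromorphicOrderAt Θ z = 1 := by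
  rw [(hΘ.analyticAt z).meromorphicOrderAt_eq,
    (hΘ.analyticAt z).analyticOrderAt_eq_one_of_zero_deriv_ne_zero ((hΘ.eq_zero_iff z).mpr hz)
      (hΘ.deriv_ne_zero z hz)]
  rfl

lemma meromorphicOrderAt_of_notMem {z : ℂ} (hz : z ∉ L.lattice) : meromorphicOrderAt Θ z = 0 := by
  rw [(hΘ.analyticAt z).meromorphicOrderAt_eq,
    (hΘ.analyticAt z).analyticOrderAt_eq_zero.mpr (mt (hΘ.eq_zero_iff z).mp hz)]
  rfl

/-- The product formula for differences of values of the Weierstrass `℘`-function. -/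
theorem exists_weierstrassP_sub_mul_sq {w : ℂ} (hw : 2 * w ∉ L.lattice) :
    ∃ C ≠ 0, ∀ z ∉ L.lattice,
      (L.weierstrassP z - L.weierstrassP w) * Θ z ^ 2 = C * (Θ (z + w) * Θ (z - w)) := by
  have hw1 : w ∉ L.lattice := fun h ↦ hw (by rw [two_mul]; exact add_mem h h)
  set f : ℂ → ℂ := fun z ↦ L.weierstrassP z - L.weierstrassP w with hf
  set g : ℂ → ℂ := fun z ↦ Θ (z + w) * Θ (z - w) with hg
  set h : ℂ → ℂ := fun z ↦ f z * Θ z ^ 2 / g z with hh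
  have hp1 : ∀ z, AnalyticAt ℂ (fun z ↦ Θ (z + w)) z := fun z ↦
    (hΘ.differentiable.comp (differentiable_id.add_const w)).analyticAt z
  have hm1 : ∀ z, AnalyticAt ℂ (fun z ↦ Θ (z - w)) z := fun z ↦
    (hΘ.differentiable.comp (differentiable_id.sub_const w)).analyticAt z
  have hfm : ∀ z, MeromorphicAt f z := fun z ↦
    (L.meromorphic_weierstrassP z).sub (MeromorphicAt.const _ _)
  have hs2 : ∀ z, MeromorphicAt (fun z ↦ Θ z ^ 2) z := fun z ↦
    ((hΘ.analyticAt z).pow 2).meromorphicAt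
  have hhm : ∀ z, MeromorphicAt h z := fun z ↦
    ((hfm z).mul (hs2 z)).div ((hp1 z).mul (hm1 z)).meromorphicAt
  have hord : ∀ z, meromorphicOrderAt h z = meromorphicOrderAt f z +
      2 * meromorphicOrderAt Θ z -
      (meromorphicOrderAt Θ (z + w) + meromorphicOrderAt Θ (z - w)) := fun z ↦ by
    have h1 : MeromorphicAt (Θ ^ 2) z := hs2 z
    have h2 : MeromorphicAt (Θ ∘ (· + w)) z := (hp1 z).meromorphicAt
    have h3 : MeromorphicAt (Θ ∘ (· - w)) z := (hm1 z).meromorphicAt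
    change meromorphicOrderAt ((f * Θ ^ 2) / ((Θ ∘ (· + w)) * (Θ ∘ (· - w)))) z = _
    rw [meromorphicOrderAt_div ((hfm z).mul h1) (h2.mul h3), meromorphicOrderAt_mul (hfm z) h1,
      meromorphicOrderAt_pow (hΘ.analyticAt z).meromorphicAt, meromorphicOrderAt_mul h2 h3,
      meromorphicOrderAt_comp_add_const_eq_meromorphicOrderAt,
      meromorphicOrderAt_comp_sub_const_eq_meromorphicOrderAt]
    rfl
  have hf_an : ∀ z ∉ L.lattice, AnalyticAt ℂ f z := fun z hz ↦
    (L.analyticOnNhd_weierstrassP z hz).sub analyticAt_const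
  have hf_zero : ∀ z, z + w ∈ L.lattice ∨ z - w ∈ L.lattice → f z = 0 := by
    rintro z (hz | hz)
    · have := L.weierstrassP_add_coe (-w) ⟨_, hz⟩
      rw [L.weierstrassP_neg] at this
      simp only [hf, ← this]
      simp
    · have := L.weierstrassP_add_coe w ⟨_, hz⟩
      simp only [hf, ← this]
      simp
  have hord0 : ∀ z ∈ L.lattice, meromorphicOrderAt h z = 0 := fun z hz ↦ by
    have h1 : meromorphicOrderAt f z = -2 := by
      rw [← L.order_weierstrassP z hz, hf]
      simp only [sub_eq_add_neg]
      refine meromorphicOrderAt_add_eq_left_of_lt (MeromorphicAt.const _ _) ?_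
      rw [L.order_weierstrassP z hz]
      exact lt_of_lt_of_le (by decide) (analyticAt_const (v := -L.weierstrassP w)).meromorphicOrderAt_nonneg
    rw [hord, h1, hΘ.meromorphicOrderAt_of_mem hz,
      hΘ.meromorphicOrderAt_of_notMem (mt (Submodule.add_mem_iff_right _ hz).mp hw1),
      hΘ.meromorphicOrderAt_of_notMem (mt (Submodule.sub_mem_iff_right _ hz).mp hw1)]
    rfl
  have hf_pos : ∀ z ∉ L.lattice, z + w ∈ L.lattice ∨ z - w ∈ L.lattice →
      0 ≤ meromorphicOrderAt f z - 1 := fun z hz hz' ↦ by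
    have h1 := (hf_an z hz).analyticOrderAt_ne_zero.mpr (hf_zero z hz')
    rw [(hf_an z hz).meromorphicOrderAt_eq]
    cases hn : analyticOrderAt f z with
    | top => exact le_top
    | coe n =>
      have h2 : n ≠ 0 := by rintro rfl; exact h1 hn
      have h3 : (0 : ℤ) ≤ (n : ℤ) - 1 := by omega
      exact WithTop.coe_le_coe.mpr h3
  have hnonneg : ∀ z, 0 ≤ meromorphicOrderAt h z := fun z ↦ by
    by_cases hz : z ∈ L.lattice
    · exact (hord0 z hz).ge
    have hnot : ¬ (z + w ∈ L.lattice ∧ z - w ∈ L.lattice) := fun H ↦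
      hw (by have := sub_mem H.1 H.2; rwa [add_sub_sub_cancel, ← two_mul] at this)
    by_cases h1 : z + w ∈ L.lattice
    · rw [hord, hΘ.meromorphicOrderAt_of_mem h1, hΘ.meromorphicOrderAt_of_notMem hz,
        hΘ.meromorphicOrderAt_of_notMem fun h2 ↦ hnot ⟨h1, h2⟩, mul_zero, add_zero, add_zero]
      exact hf_pos z hz (.inl h1)
    · by_cases h2 : z - w ∈ L.lattice
      · rw [hord, hΘ.meromorphicOrderAt_of_mem h2, hΘ.meromorphicOrderAt_of_notMem hz,
          hΘ.meromorphicOrderAt_of_notMem h1, mul_zero, add_zero, zero_add]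
        exact hf_pos z hz (.inr h2)
      · exact AnalyticAt.meromorphicOrderAt_nonneg <|
          ((hf_an z hz).mul ((hΘ.analyticAt z).pow 2)).div ((hp1 z).mul (hm1 z))
            (mul_ne_zero (mt (hΘ.eq_zero_iff _).mp h1) (mt (hΘ.eq_zero_iff _).mp h2))
  have hper : ∀ l ∈ L.lattice, h.Periodic l := by
    have hgen : ∀ l ∈ L.lattice, l ∈ ({L.ω₁, L.ω₂} : Set ℂ) → h.Periodic l := by
      intro l hl hl' z
      obtain ⟨ε, hε0, hε, hεm⟩ := hΘ.exists_factor l hl'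
      have h1 : Θ (z + l + w) = ε (z + w) * Θ (z + w) := by rw [← hε]; ring_nf
      have h2 : Θ (z + l - w) = ε (z - w) * Θ (z - w) := by rw [← hε]; ring_nf
      have h3 : L.weierstrassP (z + l) = L.weierstrassP z := L.weierstrassP_add_coe z ⟨l, hl⟩
      simp only [hh, hf, hg, h1, h2, h3, hε z]
      rw [mul_mul_mul_comm, hεm, mul_pow, mul_left_comm, mul_div_mul_left _ _ (pow_ne_zero 2 (hε0 z))]
    intro l hl
    obtain ⟨m, n, rfl⟩ := mem_lattice.mp hl
    exact ((hgen _ L.ω₁_mem_lattice (by simp)).int_mul m).add_period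
      ((hgen _ L.ω₂_mem_lattice (by simp)).int_mul n)
  obtain ⟨C, hC⟩ := L.exists_const_eventuallyEq hhm hnonneg hper
  refine ⟨C, ?_, fun z hz ↦ ?_⟩
  · rintro rfl
    have h1 := hord0 0 (zero_mem _)
    rw [meromorphicOrderAt_congr (hC 0), meromorphicOrderAt_const] at h1
    simp at h1
  · by_cases hzw : z + w ∈ L.lattice ∨ z - w ∈ L.lattice
    · have h1 : Θ (z + w) * Θ (z - w) = 0 := by
        rwa [mul_eq_zero, hΘ.eq_zero_iff, hΘ.eq_zero_iff]
      rw [h1, mul_zero]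
      exact mul_eq_zero_of_left (hf_zero z hzw) _
    · push Not at hzw
      have hg0 : g z ≠ 0 := mul_ne_zero (mt (hΘ.eq_zero_iff _).mp hzw.1)
        (mt (hΘ.eq_zero_iff _).mp hzw.2)
      have hha : AnalyticAt ℂ h z :=
        ((hf_an z hz).mul ((hΘ.analyticAt z).pow 2)).div ((hp1 z).mul (hm1 z)) hg0
      have h1 : h z = C := tendsto_nhds_unique
        (hha.continuousAt.tendsto.mono_left nhdsWithin_le_nhds)
        (tendsto_const_nhds.congr' (hC z).symm)
      exact (div_eq_iff hg0).mp h1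

end IsTheta

end PeriodPair

namespace UpperHalfPlane

open Filter Topology
open scoped Manifold ModularForm PowerSeries

local notation "𝕢" => Function.Periodic.qParam

section

/-- `f` is given by the Laurent expansion `q ^ k * P(q)`, `q = exp (2πiτ/N)`, where `P` is a power
series with algebraic integer coefficients converging on the unit disc. -/
def HasExpansion (N : ℕ) (k : ℤ) (P : ℂ⟦X⟧) (f : ℍ → ℂ) : Prop :=
  P.IsAdmissible ∧ ∀ τ : ℍ, f τ = 𝕢 N τ ^ k * P.sumAt (𝕢 N τ)

/-- `f` has an expansion starting in degree `k` whose leading coefficient is an algebraic unit. -/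
def HasUnitExpansion (N : ℕ) (k : ℤ) (f : ℍ → ℂ) : Prop :=
  ∃ P, HasExpansion N k P f ∧ IsIntegral ℤ (PowerSeries.coeff 0 P)⁻¹ ∧ PowerSeries.coeff 0 P ≠ 0

variable {N : ℕ} [NeZero N] {k l : ℤ} {P Q : ℂ⟦X⟧} {f g : ℍ → ℂ}

lemma norm_qParam_lt (τ : ℍ) : ‖𝕢 N τ‖ < 1 := norm_qParam_lt_one N τ

lemma exists_qParam_eq {x : ℂ} (h0 : x ≠ 0) (h1 : ‖x‖ < 1) : ∃ τ : ℍ, 𝕢 N τ = x := by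
  have hN : (0 : ℝ) < N := by exact_mod_cast NeZero.pos N
  have him : 0 < (Function.Periodic.invQParam N x).im := by
    rw [Function.Periodic.im_invQParam]
    have := Real.log_neg (norm_pos_iff.mpr h0) h1
    have : 0 < (N : ℝ) / (2 * Real.pi) := by positivity
    rw [neg_div]
    nlinarith
  exact ⟨⟨_, him⟩, Function.Periodic.qParam_right_inv hN.ne' h0⟩

/-- Identities between functions of `q` extend to `q = 0`. -/
lemma eq_at_zero_of_forall_qParam {F G : ℂ → ℂ} (hF : ContinuousAt F 0) (hG : ContinuousAt G 0)
    (h : ∀ τ : ℍ, F (𝕢 N τ) = G (𝕢 N τ)) : F 0 = G 0 := by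
  refine tendsto_nhds_unique (l := 𝓝[≠] (0 : ℂ)) (hF.tendsto.mono_left nhdsWithin_le_nhds)
    ((hG.tendsto.mono_left nhdsWithin_le_nhds).congr' ?_)
  filter_upwards [self_mem_nhdsWithin, nhdsWithin_le_nhds (Metric.ball_mem_nhds (0 : ℂ) one_pos)]
    with x hx hx1
  obtain ⟨τ, rfl⟩ := exists_qParam_eq (N := N) hx (by simpa using hx1)
  exact (h τ).symm

namespace HasExpansion

lemma mul (hf : HasExpansion N k P f) (hg : HasExpansion N l Q g) :
    HasExpansion N (k + l) (P * Q) (f * g) := by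
  refine ⟨hf.1.mul hg.1, fun τ ↦ ?_⟩
  rw [Pi.mul_apply, hf.2, hg.2, hf.1.sumAt_mul hg.1 (norm_qParam_lt τ),
    zpow_add₀ (Function.Periodic.qParam_ne_zero _)]
  ring

lemma add (hf : HasExpansion N k P f) (hg : HasExpansion N k Q g) :
    HasExpansion N k (P + Q) (f + g) := by
  refine ⟨hf.1.add hg.1, fun τ ↦ ?_⟩
  rw [Pi.add_apply, hf.2, hg.2, hf.1.sumAt_add hg.1 (norm_qParam_lt τ)]
  ring

omit [NeZero N] in
lemma const {c : ℂ} (hc : IsIntegral ℤ c) :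
    HasExpansion N 0 (PowerSeries.C c) (fun _ ↦ c) := by
  refine ⟨.C hc, fun τ ↦ ?_⟩
  rw [PowerSeries.sumAt, tsum_eq_single 0]
  · simp
  · intro n hn
    simp [PowerSeries.coeff_C, hn]

lemma lower (hf : HasExpansion N k P f) (m : ℕ) :
    HasExpansion N (k - m) (PowerSeries.X ^ m * P) f := by
  refine ⟨(PowerSeries.IsAdmissible.X_pow m).mul hf.1, fun τ ↦ ?_⟩
  have hX : ∀ x : ℂ, (PowerSeries.X ^ m : ℂ⟦X⟧).sumAt x = x ^ m := fun x ↦ by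
    rw [PowerSeries.sumAt, tsum_eq_single m]
    · simp
    · intro n hn
      simp [PowerSeries.coeff_X_pow, hn]
  have h0 : 𝕢 N τ ≠ 0 := Function.Periodic.qParam_ne_zero _
  rw [hf.2, (PowerSeries.IsAdmissible.X_pow m).sumAt_mul hf.1 (norm_qParam_lt τ), hX,
    zpow_sub₀ h0, zpow_natCast]
  field_simp

lemma raise (hf : HasExpansion N k P f) (h0 : PowerSeries.coeff 0 P = 0) :
    HasExpansion N (k + 1) (PowerSeries.mk fun n ↦ PowerSeries.coeff (n + 1) P) f := by
  refine ⟨hf.1.shift 1, fun τ ↦ ?_⟩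
  have hq : 𝕢 N τ ≠ 0 := Function.Periodic.qParam_ne_zero _
  rw [hf.2, PowerSeries.sumAt, PowerSeries.sumAt,
    (hf.1.summable _ (norm_qParam_lt τ)).tsum_eq_zero_add, h0, zero_mul, zero_add,
    zpow_add_one₀ hq, mul_assoc, ← tsum_mul_left (a := 𝕢 N τ)]
  congr 1
  refine tsum_congr fun n ↦ ?_
  rw [PowerSeries.coeff_mk]
  ring

lemma const_mul (hf : HasExpansion N k P f) {c : ℂ} (hc : IsIntegral ℤ c) :
    HasExpansion N k (PowerSeries.C c * P) (fun τ ↦ c * f τ) := by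
  simpa [Pi.mul_def] using! (const (N := N) hc).mul hf

lemma neg (hf : HasExpansion N k P f) :
    HasExpansion N k (PowerSeries.C (-1) * P) (-f) := by
  simpa [Pi.neg_def] using hf.const_mul (c := -1) isIntegral_one.neg

lemma inv (hf : HasExpansion N k P f) (h0 : PowerSeries.coeff 0 P ≠ 0)
    (hu : IsIntegral ℤ (PowerSeries.coeff 0 P)⁻¹) (hne : ∀ τ, f τ ≠ 0) :
    HasExpansion N (-k) P⁻¹ f⁻¹ := by
  have hne' : ∀ x : ℂ, ‖x‖ < 1 → P.sumAt x ≠ 0 := by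
    intro x hx
    rcases eq_or_ne x 0 with rfl | hx0
    · rwa [PowerSeries.sumAt_zero]
    · obtain ⟨τ, rfl⟩ := exists_qParam_eq (N := N) hx0 hx
      intro h
      exact hne τ (by rw [hf.2, h, mul_zero])
  have hP := hf.1.inv hu hne'
  refine ⟨hP, fun τ ↦ ?_⟩
  rw [Pi.inv_apply, hf.2, hf.1.sumAt_inv hP h0 (norm_qParam_lt τ), mul_inv, zpow_neg]

/-- Change of the parameter `q`. -/
lemma comp {M : ℕ} [NeZero M] (hf : HasExpansion M k P f) {σ : ℍ → ℍ} {ζ : ℂ} {n a : ℕ}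
    (hn : n ≠ 0) (hζ : ζ ^ n = 1) (ha : 0 < a) (hσ : ∀ τ, 𝕢 M (σ τ) = ζ * 𝕢 N τ ^ a) :
    ∃ Q, HasExpansion N (a * k) Q (f ∘ σ) ∧
      PowerSeries.coeff 0 Q = ζ ^ k * PowerSeries.coeff 0 P := by
  have hint : ∀ k : ℤ, IsIntegral ℤ (ζ ^ k) := by
    intro k
    refine IsIntegral.of_pow (Nat.pos_of_ne_zero hn) ?_
    rw [← zpow_natCast, ← zpow_mul, mul_comm, zpow_mul, zpow_natCast, hζ, one_zpow]
    exact isIntegral_one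
  obtain ⟨Q, hQ, hQ0, hQs⟩ := hf.1.exists_subst (by simpa using hint 1)
    (Complex.norm_eq_one_of_pow_eq_one hζ hn) ha
  have hC := HasExpansion.const (N := N) (hint k)
  have h2 := hC.2 I
  simp only [zpow_zero, one_mul] at h2
  refine ⟨PowerSeries.C (ζ ^ k) * Q, ⟨hC.1.mul hQ, fun τ ↦ ?_⟩, by simp [hQ0]⟩
  have h3 : ζ ^ k = (PowerSeries.C (ζ ^ k)).sumAt (𝕢 N τ) := by simpa using! hC.2 τ
  rw [hC.1.sumAt_mul hQ (norm_qParam_lt τ), ← h3, hQs _ (norm_qParam_lt τ), ← hσ,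
    Function.comp_apply, hf.2, hσ, mul_zpow, ← zpow_natCast, ← zpow_mul]
  ring

lemma mdifferentiable (hf : HasExpansion N k P f) : MDiff f := by
  rw [UpperHalfPlane.mdifferentiable_iff]
  have hd : DifferentiableOn ℂ (fun z ↦ 𝕢 N z ^ k * P.sumAt (𝕢 N z)) {z : ℂ | 0 < z.im} := by
    refine DifferentiableOn.mul (fun z _ ↦ ?_) ?_
    · exact (((Function.Periodic.differentiable_qParam z).zpow
        (.inl (Function.Periodic.qParam_ne_zero _)))).differentiableWithinAt
    · refine hf.1.differentiableOn_sumAt.comp Function.Periodic.differentiable_qParam.differentiableOn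
        fun z hz ↦ ?_
      simpa using norm_qParam_lt (N := N) ⟨z, hz⟩
  refine hd.congr fun z hz ↦ ?_
  rw [Function.comp_apply, ofComplex_apply_of_im_pos hz, hf.2]

lemma isBoundedAtImInfty (hf : HasExpansion N 0 P f) : IsBoundedAtImInfty f := by
  have hN : (0 : ℝ) < N := by exact_mod_cast NeZero.pos N
  have h1 : Tendsto (fun τ : ℍ ↦ P.sumAt (𝕢 N τ)) atImInfty (𝓝 (P.sumAt 0)) := by
    refine hf.1.continuousAt_sumAt.tendsto.comp ?_
    exact ((Function.Periodic.qParam_tendsto hN).mono_right nhdsWithin_le_nhds).comp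
      (tendsto_comap_iff.mpr tendsto_comap)
  have h2 : f = fun τ : ℍ ↦ P.sumAt (𝕢 N τ) := by
    ext τ
    rw [hf.2, zpow_zero, one_mul]
  rw [h2]
  exact h1.isBigO_one ℝ

end HasExpansion

end

section

variable {N : ℕ} [NeZero N] {k l : ℤ} {P Q : ℂ⟦X⟧} {f g : ℍ → ℂ}

lemma HasExpansion.lower_to (hf : HasExpansion N k P f) (h : l ≤ k) :
    HasExpansion N l (PowerSeries.X ^ (k - l).toNat * P) f := by
  convert hf.lower (k - l).toNat using 1
  omega

lemma HasExpansion.pow (hf : HasExpansion N k P f) (n : ℕ) :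
    HasExpansion N (n * k) (P ^ n) (f ^ n) := by
  induction n with
  | zero => simpa using! const (N := N) isIntegral_one
  | succ n ih =>
    rw [pow_succ, pow_succ]
    convert ih.mul hf using 1
    push_cast
    ring

variable (N) in
/-- The ring of functions on `ℍ` with Laurent expansions in `exp (2πiτ/N)` with algebraic integer
coefficients. -/
def integralExpansions : Subring (ℍ → ℂ) where
  carrier := {f | ∃ k P, HasExpansion N k P f}
  mul_mem' := fun ⟨_, _, hf⟩ ⟨_, _, hg⟩ ↦ ⟨_, _, hf.mul hg⟩
  one_mem' := ⟨_, _, HasExpansion.const isIntegral_one⟩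
  add_mem' := fun ⟨k, _, hf⟩ ⟨l, _, hg⟩ ↦
    ⟨_, _, (hf.lower_to (min_le_left k l)).add (hg.lower_to (min_le_right k l))⟩
  zero_mem' := ⟨_, _, HasExpansion.const isIntegral_zero⟩
  neg_mem' := fun ⟨_, _, hf⟩ ↦ ⟨_, _, hf.neg⟩

lemma exists_hasExpansion_neg (hf : f ∈ integralExpansions N) :
    ∃ (K : ℕ) (P : ℂ⟦X⟧), HasExpansion N (-K) P f := by
  obtain ⟨k, P, hf⟩ := hf
  exact ⟨(-k).toNat, _, hf.lower_to (by omega)⟩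

namespace HasUnitExpansion

lemma mem (hf : HasUnitExpansion N k f) : f ∈ integralExpansions N :=
  let ⟨P, hP, _⟩ := hf
  ⟨k, P, hP⟩

lemma mul (hf : HasUnitExpansion N k f) (hg : HasUnitExpansion N l g) :
    HasUnitExpansion N (k + l) (f * g) := by
  obtain ⟨P, hP, hPu, hP0⟩ := hf
  obtain ⟨Q, hQ, hQu, hQ0⟩ := hg
  refine ⟨_, hP.mul hQ, ?_, ?_⟩
  · simpa only [PowerSeries.coeff_zero_eq_constantCoeff_apply, map_mul, mul_inv] using hPu.mul hQu
  · simpa only [PowerSeries.coeff_zero_eq_constantCoeff_apply, map_mul] using mul_ne_zero hP0 hQ0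

omit [NeZero N] in
lemma const {c : ℂ} (hc : IsIntegral ℤ c) (hcu : IsIntegral ℤ c⁻¹) (h0 : c ≠ 0) :
    HasUnitExpansion N 0 (fun _ ↦ c) :=
  ⟨_, .const hc, by simpa using hcu, by simpa using h0⟩

lemma prod {ι : Type*} (s : Finset ι) {f : ι → ℍ → ℂ} {k : ι → ℤ}
    (h : ∀ i ∈ s, HasUnitExpansion N (k i) (f i)) :
    HasUnitExpansion N (∑ i ∈ s, k i) (∏ i ∈ s, f i) := by
  classical
  induction s using Finset.induction_on with
  | empty => simpa using! const (N := N) isIntegral_one (by simpa using isIntegral_one) one_ne_zero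
  | insert a s ha ih =>
    rw [Finset.sum_insert ha, Finset.prod_insert ha]
    exact (h a (Finset.mem_insert_self a s)).mul
      (ih fun i hi ↦ h i (Finset.mem_insert_of_mem hi))

lemma inv (hf : HasUnitExpansion N k f) (hne : ∀ τ, f τ ≠ 0) :
    HasUnitExpansion N (-k) f⁻¹ := by
  obtain ⟨P, hP, hPu, hP0⟩ := hf
  refine ⟨_, hP.inv hP0 hPu hne, ?_, ?_⟩
  · rw [PowerSeries.coeff_inv, if_pos rfl, inv_inv,
      ← PowerSeries.coeff_zero_eq_constantCoeff_apply]
    exact hP.1.integral 0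
  · rw [PowerSeries.coeff_inv, if_pos rfl, ← PowerSeries.coeff_zero_eq_constantCoeff_apply]
    exact inv_ne_zero hP0

lemma neg (hf : HasUnitExpansion N k f) : HasUnitExpansion N k (-f) := by
  convert (const (N := N) (c := -1) isIntegral_one.neg (by simpa using isIntegral_one.neg)
    (by simp)).mul hf using 1
  · simp
  · ext; simp

lemma sub_of_lt (hf : HasUnitExpansion N k f) (hg : HasExpansion N l Q g) (hkl : k < l) :
    HasUnitExpansion N k (f - g) := by
  obtain ⟨P, hP, hPu, hP0⟩ := hf
  have h0 : PowerSeries.coeff 0 (PowerSeries.C (-1) * (PowerSeries.X ^ (l - k).toNat * Q)) = 0 := by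
    simp [show (l - k).toNat ≠ 0 by omega]
  refine ⟨_, sub_eq_add_neg f g ▸ hP.add (hg.lower_to hkl.le).neg, ?_, ?_⟩
  · rwa [map_add, h0, add_zero]
  · rwa [map_add, h0, add_zero]

lemma comp {M : ℕ} [NeZero M] (hf : HasUnitExpansion M k f) {σ : ℍ → ℍ} {ζ : ℂ} {n a : ℕ}
    (hn : n ≠ 0) (hζ : ζ ^ n = 1) (ha : 0 < a) (hσ : ∀ τ, 𝕢 M (σ τ) = ζ * 𝕢 N τ ^ a) :
    HasUnitExpansion N (a * k) (f ∘ σ) := by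
  obtain ⟨P, hP, hPu, hP0⟩ := hf
  obtain ⟨Q, hQ, hQ0⟩ := hP.comp hn hζ ha hσ
  have hζ0 : ζ ≠ 0 := by
    rintro rfl
    simp [hn] at hζ
  refine ⟨Q, hQ, ?_, ?_⟩
  · rw [hQ0, mul_inv]
    refine .mul (IsIntegral.of_pow (Nat.pos_of_ne_zero hn) ?_) hPu
    rw [← zpow_neg, ← zpow_natCast, ← zpow_mul, mul_comm, zpow_mul, zpow_natCast, hζ, one_zpow]
    exact isIntegral_one
  · rw [hQ0]
    exact mul_ne_zero (zpow_ne_zero _ hζ0) hP0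

end HasUnitExpansion

lemma qParam_pow_eq (τ : ℍ) : 𝕢 N τ ^ N = 𝕢 1 τ := by
  have : (N : ℂ) ≠ 0 := NeZero.ne _
  rw [Function.Periodic.qParam, Function.Periodic.qParam, ← Complex.exp_nat_mul]
  congr 1
  push_cast
  field_simp

/-- The modular `j`-function, as the quotient `E₄³/Δ`. -/
noncomputable def kleinJ (τ : ℍ) : ℂ := ModularForm.E₄ τ ^ 3 / ModularForm.discriminant τ

lemma kleinJ_smul (γ : SL(2, ℤ)) (τ : ℍ) : kleinJ (γ • τ) = kleinJ τ := by
  set g := Matrix.SpecialLinearGroup.mapGL ℝ γ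
  have h1 : ModularForm.E₄ (γ • τ) = denom g τ ^ (4 : ℤ) * ModularForm.E₄ τ :=
    SlashInvariantForm.slash_action_eqn'' (Γ := 𝒮ℒ) ModularForm.E₄ (γ := g) ⟨γ, rfl⟩ τ
  have h2 : ModularForm.discriminant (γ • τ) = denom g τ ^ (12 : ℤ) * ModularForm.discriminant τ :=
    SlashInvariantForm.slash_action_eqn'' (Γ := 𝒮ℒ) CuspForm.discriminant (γ := g) ⟨γ, rfl⟩ τ
  have h3 := denom_ne_zero g τ
  have h4 := ModularForm.discriminant_ne_zero τ
  rw [kleinJ, kleinJ, h1, h2]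
  simp only [zpow_ofNat]
  field_simp

lemma hasExpansion_discriminant : ∃ P : ℂ⟦X⟧, HasExpansion 1 1 P ModularForm.discriminant ∧
    PowerSeries.coeff 0 P = 1 := by
  obtain ⟨Q, hQ, hQ0, hQs⟩ := PowerSeries.IsAdmissible.exists_tprod (c := fun _ ↦ -1)
    (e := fun i ↦ i + 1) (fun _ ↦ isIntegral_one.neg) (by simp) (by simp)
  have h1 : HasExpansion 1 0 Q fun τ : ℍ ↦ Q.sumAt (𝕢 1 τ) := ⟨hQ, fun τ ↦ by simp⟩
  have h3 (n : ℕ) (τ : ℍ) : (Q ^ n).sumAt (𝕢 1 τ) = Q.sumAt (𝕢 1 τ) ^ n := by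
    have := (h1.pow n).2 τ
    rw [mul_zero, zpow_zero, one_mul, Nat.cast_one] at this
    exact this.symm
  have h4 (n : ℕ) : PowerSeries.coeff 0 (Q ^ n) = 1 := by
    rw [PowerSeries.coeff_zero_eq_constantCoeff_apply] at *
    rw [map_pow, hQ0, one_pow]
  refine ⟨Q ^ 24, ⟨(h1.pow 24).1, fun τ ↦ ?_⟩, h4 24⟩
  rw [Nat.cast_one, h3, zpow_one, ModularForm.discriminant, ModularForm.eta, mul_pow]
  have h5 : 𝕢 24 τ ^ 24 = 𝕢 1 τ := by simpa using qParam_pow_eq (N := 24) τ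
  have h6 : ∏' n, (1 - ModularForm.eta_q n τ) = Q.sumAt (𝕢 1 τ) := by
    rw [hQs _ (by simpa using norm_qParam_lt (N := 1) τ)]
    refine tprod_congr fun n ↦ ?_
    rw [ModularForm.eta_q_eq_pow, Function.Periodic.qParam]
    simp [sub_eq_add_neg]
  rw [h5, h6]

open ModularFormClass ModularForm EisensteinSeries in
lemma hasExpansion_E₄ : ∃ P : ℂ⟦X⟧, HasExpansion 1 0 P E₄ ∧ PowerSeries.coeff 0 P = 1 := by
  have hs : ∀ τ : ℍ, HasSum (fun m : ℕ ↦ (qExpansion 1 E₄).coeff m • 𝕢 1 τ ^ m) (E₄ τ) :=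
    fun τ ↦ by simpa using ModularForm.hasSum_qExpansion (f := E₄) (h := 1) one_pos (by simp) τ
  refine ⟨qExpansion 1 E₄, ⟨⟨fun n ↦ ?_, fun x hx ↦ ?_⟩, fun τ ↦ ?_⟩,
    E_qExpansion_coeff_zero _ ⟨2, rfl⟩⟩
  · rw [E_qExpansion_coeff _ ⟨2, rfl⟩, show bernoulli 4 = -1 / 30 by decide +kernel]
    split_ifs
    · exact isIntegral_one
    · convert isIntegral_algebraMap (R := ℤ) (A := ℂ) (x := 240 * ArithmeticFunction.sigma 3 n)
        using 1
      push_cast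
      norm_num
  · rcases eq_or_ne x 0 with rfl | h0
    · refine summable_of_ne_finset_zero (s := {0}) fun n hn ↦ ?_
      simp [Finset.notMem_singleton.mp hn]
    · obtain ⟨τ, rfl⟩ := exists_qParam_eq (N := 1) h0 hx
      simpa using (hs τ).summable
  · rw [zpow_zero, one_mul, PowerSeries.sumAt]
    simpa using (hs τ).tsum_eq.symm

lemma hasExpansion_kleinJ : ∃ P : ℂ⟦X⟧, HasExpansion N (-N) P kleinJ ∧
    PowerSeries.coeff 0 P = 1 := by
  obtain ⟨P, hP, hP0⟩ := hasExpansion_E₄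
  obtain ⟨Q, hQ, hQ0⟩ := hasExpansion_discriminant
  have h1 := (hP.pow 3).mul
    (hQ.inv (by simp [hQ0]) (by simpa [hQ0] using isIntegral_one) ModularForm.discriminant_ne_zero)
  have h2 : ((3 : ℕ) * 0 + -1 : ℤ) = -1 := by norm_num
  rw [h2] at h1
  obtain ⟨R, hR, hR0⟩ := h1.comp (N := N) (σ := id) (ζ := 1) (n := 1) (a := N) one_ne_zero
    (one_pow 1) (NeZero.pos N) fun τ ↦ by simpa using! (qParam_pow_eq τ).symm
  rw [mul_neg_one] at hR
  refine ⟨R, ?_, ?_⟩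
  · convert hR using 1
    ext τ
    simp [kleinJ, div_eq_mul_inv]
  · rw [PowerSeries.coeff_zero_eq_constantCoeff_apply] at *
    simp [hR0, hP0, hQ0]

end

section

/-- The ring of `SL(2, ℤ)`-invariant functions. -/
def levelOneInvariants : Subring (ℍ → ℂ) where
  carrier := {f | ∀ (γ : SL(2, ℤ)) (τ : ℍ), f (γ • τ) = f τ}
  mul_mem' hf hg γ τ := congrArg₂ (· * ·) (hf γ τ) (hg γ τ)
  one_mem' _ _ := rfl
  add_mem' hf hg γ τ := congrArg₂ (· + ·) (hf γ τ) (hg γ τ)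
  zero_mem' _ _ := rfl
  neg_mem' hf γ τ := congrArg Neg.neg (hf γ τ)

lemma const_mem_levelOneInvariants (c : ℂ) : (fun _ ↦ c) ∈ levelOneInvariants := fun _ _ ↦ rfl

lemma kleinJ_mem_levelOneInvariants : kleinJ ∈ levelOneInvariants := kleinJ_smul

variable {N : ℕ} [NeZero N] {k l : ℤ} {P Q : ℂ⟦X⟧} {f g : ℍ → ℂ}

lemma exists_const_of_mem_levelOneInvariants (hf : f ∈ levelOneInvariants) (hd : MDiff f)
    (hb : IsBoundedAtImInfty f) : ∃ c, ∀ τ, f τ = c := by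
  have hs : ∀ γ : SL(2, ℤ), f ∣[(0 : ℤ)] γ = f := fun γ ↦ by
    ext τ
    rw [ModularForm.SL_slash_apply, hf γ τ, neg_zero, zpow_zero, mul_one]
  let F : ModularForm 𝒮ℒ 0 :=
    { toFun := f
      slash_action_eq' := by
        rintro A ⟨A, rfl⟩
        exact hs A
      holo' := hd
      bdd_at_cusps' := fun hc ↦ by
        rw [Subgroup.IsArithmetic.isCusp_iff_isCusp_SL2Z] at hc
        rw [OnePoint.isBoundedAt_iff_forall_SL2Z hc]
        intro γ _
        rw [hs]
        exact hb }
  obtain ⟨c, hc⟩ := ModularFormClass.levelOne_weight_zero_const F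
  exact ⟨c, fun τ ↦ congrFun hc τ⟩

namespace HasExpansion

lemma eq_coeff_zero_of_invariant (h : HasExpansion N 0 P f) (hf : f ∈ levelOneInvariants)
    (τ : ℍ) : f τ = PowerSeries.coeff 0 P := by
  obtain ⟨c, hc⟩ := exists_const_of_mem_levelOneInvariants hf h.mdifferentiable h.isBoundedAtImInfty
  have h1 : (fun _ : ℂ ↦ c) 0 = P.sumAt 0 :=
    eq_at_zero_of_forall_qParam (N := N) continuousAt_const h.1.continuousAt_sumAt fun τ ↦ by
      simpa [hc] using h.2 τ
  rw [hc, ← PowerSeries.sumAt_zero, ← h1]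

lemma coeff_zero_eq_zero_of_not_dvd (h : HasExpansion N k P f) (hf : f ∈ levelOneInvariants)
    (hk : ¬ (N : ℤ) ∣ k) : PowerSeries.coeff 0 P = 0 := by
  have hN : (N : ℂ) ≠ 0 := NeZero.ne _
  set ζ : ℂ := Complex.exp (2 * Real.pi * Complex.I / N) with hζ
  have hprim : IsPrimitiveRoot ζ N := Complex.isPrimitiveRoot_exp N (NeZero.ne N)
  have hT : ∀ τ : ℍ, 𝕢 N (ModularGroup.T • τ : ℍ) = ζ * 𝕢 N τ := fun τ ↦ by
    rw [modular_T_smul, coe_vadd, Function.Periodic.qParam, Function.Periodic.qParam, hζ,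
      ← Complex.exp_add]
    congr 1
    push_cast
    field_simp
  have h1 : (fun x ↦ ζ ^ k * P.sumAt (ζ * x)) 0 = P.sumAt 0 := by
    refine eq_at_zero_of_forall_qParam (N := N) (continuousAt_const.mul
      (ContinuousAt.comp (g := P.sumAt) ?_ (continuousAt_const.mul continuousAt_id)))
      h.1.continuousAt_sumAt fun τ ↦ ?_
    · simpa using h.1.continuousAt_sumAt
    · have h2 := hf ModularGroup.T τ
      have h0 : 𝕢 N τ ^ k ≠ 0 := zpow_ne_zero _ (Function.Periodic.qParam_ne_zero _)
      rw [h.2, h.2, hT, mul_zpow] at h2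
      show ζ ^ k * P.sumAt (ζ * 𝕢 N τ) = P.sumAt (𝕢 N τ)
      refine mul_left_cancel₀ h0 ?_
      rw [← h2]
      ring
  simp only [mul_zero, PowerSeries.sumAt_zero] at h1
  by_contra h0
  refine hk ((hprim.zpow_eq_one_iff_dvd k).mp ?_)
  exact mul_right_cancel₀ h0 (by rw [h1, one_mul])

/-- An `SL(2, ℤ)`-invariant function with an integral expansion is an integral polynomial
in `kleinJ`. -/
lemma exists_polynomial {K : ℕ} (h : HasExpansion N (-K) P f) (hf : f ∈ levelOneInvariants) :
    ∃ p : Polynomial ℂ, (∀ i, IsIntegral ℤ (p.coeff i)) ∧ N * p.natDegree ≤ K ∧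
      (∀ d, N * d = K → p.coeff d = PowerSeries.coeff 0 P) ∧ ∀ τ, f τ = p.eval (kleinJ τ) := by
  have hN : 0 < N := NeZero.pos N
  induction K generalizing f P with
  | zero =>
    refine ⟨.C (PowerSeries.coeff 0 P), fun i ↦ ?_, by simp, fun d hd ↦ ?_, fun τ ↦ ?_⟩
    · rw [Polynomial.coeff_C]
      split_ifs
      exacts [h.1.integral 0, isIntegral_zero]
    · obtain rfl : d = 0 := by simpa [hN.ne'] using hd
      simp
    · rw [Polynomial.eval_C]
      exact eq_coeff_zero_of_invariant (by simpa using h) hf τ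
  | succ K ih =>
    by_cases hd : N ∣ K + 1
    · obtain ⟨d, hd⟩ := hd
      obtain ⟨R, hR, hR0⟩ := hasExpansion_kleinJ (N := N)
      set c := PowerSeries.coeff 0 P with hc
      have hci : IsIntegral ℤ c := h.1.integral 0
      have h1 : HasExpansion N (-(K + 1 : ℕ)) (PowerSeries.C (-c) * R ^ d)
          (fun τ ↦ -c * (kleinJ ^ d) τ) := by
        convert (hR.pow d).const_mul hci.neg using 1
        rw [hd]
        push_cast
        ring
      have h2 := (h.add h1).raise (by
        rw [PowerSeries.coeff_zero_eq_constantCoeff_apply] at *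
        simp [hR0, hc])
      have h3 : (-((K + 1 : ℕ) : ℤ) + 1) = -(K : ℤ) := by push_cast; ring
      rw [h3] at h2
      obtain ⟨p, hp, hpd, -, hpe⟩ := ih h2 (add_mem hf
        (mul_mem (const_mem_levelOneInvariants (-c)) (pow_mem kleinJ_mem_levelOneInvariants d)))
      have hpd' : p.natDegree < d := by
        by_contra! hle
        have := Nat.mul_le_mul_left N hle
        omega
      refine ⟨p + .C c * .X ^ d, fun i ↦ ?_, ?_, fun e he ↦ ?_, fun τ ↦ ?_⟩
      · rw [Polynomial.coeff_add, Polynomial.coeff_C_mul_X_pow]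
        refine (hp i).add ?_
        split_ifs
        exacts [hci, isIntegral_zero]
      · rw [hd]
        refine Nat.mul_le_mul_left N ((Polynomial.natDegree_add_le _ _).trans (max_le hpd'.le ?_))
        exact Polynomial.natDegree_C_mul_X_pow_le _ _
      · obtain rfl : e = d := Nat.eq_of_mul_eq_mul_left hN (he.trans hd)
        simp [Polynomial.coeff_eq_zero_of_natDegree_lt hpd']
      · have := hpe τ
        simp only [Pi.add_apply, Pi.pow_apply] at this
        simp only [Polynomial.eval_add, Polynomial.eval_mul, Polynomial.eval_C,
          Polynomial.eval_pow, Polynomial.eval_X, ← this]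
        ring
    · have h0 := h.coeff_zero_eq_zero_of_not_dvd hf (by rw [dvd_neg]; exact_mod_cast hd)
      have h2 := h.raise h0
      have h3 : (-((K + 1 : ℕ) : ℤ) + 1) = -(K : ℤ) := by push_cast; ring
      rw [h3] at h2
      obtain ⟨p, hp, hpd, -, hpe⟩ := ih h2 hf
      exact ⟨p, hp, hpd.trans K.le_succ, fun d hd' ↦ (hd ⟨d, hd'.symm⟩).elim, hpe⟩

end HasExpansion

/-- If an invariant function with leading coefficient a unit in a negative degree vanishes
at `τ`, then `kleinJ τ` is integral. -/
lemma isIntegral_kleinJ_of_eq_zero (h : HasUnitExpansion N k f) (hf : f ∈ levelOneInvariants)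
    (hk : k < 0) {τ : ℍ} (hτ : f τ = 0) : IsIntegral ℤ (kleinJ τ) := by
  obtain ⟨P, hP, hPu, hP0⟩ := h
  obtain ⟨K, rfl⟩ : ∃ K : ℕ, k = -K := ⟨k.natAbs, by omega⟩
  obtain ⟨p, hp, hpd, hpl, hpe⟩ := hP.exists_polynomial hf
  obtain ⟨d, hd⟩ : N ∣ K := by
    by_contra hd
    exact hP0 (hP.coeff_zero_eq_zero_of_not_dvd hf (by rw [dvd_neg]; exact_mod_cast hd))
  have hpl := hpl d hd.symm
  have hpd' : p.natDegree = d := by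
    refine le_antisymm (Nat.le_of_mul_le_mul_left (hpd.trans hd.le) (NeZero.pos N)) ?_
    exact Polynomial.le_natDegree_of_ne_zero (by rwa [hpl])
  have hlead : p.leadingCoeff = PowerSeries.coeff 0 P := by
    rw [Polynomial.leadingCoeff, hpd', hpl]
  set u := PowerSeries.coeff 0 P
  set A := integralClosure ℤ ℂ
  have hlift : Polynomial.C u⁻¹ * p ∈ Polynomial.lifts (algebraMap A ℂ) := by
    rw [Polynomial.lifts_iff_coeff_lifts]
    intro i
    rw [Polynomial.coeff_C_mul]
    exact ⟨⟨_, hPu.mul (hp i)⟩, rfl⟩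
  have hmonic : (Polynomial.C u⁻¹ * p).Monic := by
    rw [Polynomial.Monic, Polynomial.leadingCoeff_mul, Polynomial.leadingCoeff_C, hlead,
      inv_mul_cancel₀ hP0]
  obtain ⟨r, hr, -, hrm⟩ := Polynomial.lifts_and_natDegree_eq_and_monic hlift hmonic
  have : IsIntegral A (kleinJ τ) := by
    refine ⟨r, hrm, ?_⟩
    rw [Polynomial.eval₂_eq_eval_map, hr]
    simp [← hpe, hτ]
  exact isIntegral_trans (R := ℤ) (A := A) _ this

lemma coeff_prod_X_sub_C_mem_levelOneInvariants {s : Finset (ℍ → ℂ)}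
    (hs : ∀ f ∈ s, ∀ γ : SL(2, ℤ), (fun τ ↦ f (γ • τ)) ∈ s) (i : ℕ) :
    (∏ g ∈ s, (.X - .C g) : Polynomial (ℍ → ℂ)).coeff i ∈ levelOneInvariants := by
  classical
  intro γ τ
  let φ (γ : SL(2, ℤ)) : (ℍ → ℂ) →+* (ℍ → ℂ) :=
    RingHom.pi fun τ ↦ Pi.evalRingHom (fun _ ↦ ℂ) (γ • τ)
  have hφ : Function.Injective (φ γ) := fun a b hab ↦ by
    ext τ
    have := congrFun hab (γ⁻¹ • τ)
    change a (γ • γ⁻¹ • τ) = b (γ • γ⁻¹ • τ) at this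
    rwa [smul_inv_smul] at this
  have himage : s.image (φ γ) = s := by
    refine Finset.eq_of_subset_of_card_le (fun g hg ↦ ?_)
      (Finset.card_image_of_injective _ hφ).ge
    obtain ⟨e, he, rfl⟩ := Finset.mem_image.mp hg
    exact hs e he γ
  set p : Polynomial (ℍ → ℂ) := ∏ g ∈ s, (.X - .C g) with hp
  have hmap : p.map (φ γ) = p := by
    conv_rhs => rw [hp, ← himage, Finset.prod_image hφ.injOn]
    simp [hp, Polynomial.map_prod]
  have := congrFun (congrArg (Polynomial.coeff · i) hmap) τ
  simpa only [Polynomial.coeff_map] using! this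

/-- The members of a finite `SL(2, ℤ)`-stable family of functions with integral expansions are
integral wherever `kleinJ` is. -/
lemma isIntegral_of_finite_stable {F : Set (ℍ → ℂ)} (hF : F.Finite)
    (hmem : ∀ f ∈ F, f ∈ integralExpansions N)
    (hstab : ∀ f ∈ F, ∀ γ : SL(2, ℤ), (fun τ ↦ f (γ • τ)) ∈ F) {τ : ℍ}
    (hτ : IsIntegral ℤ (kleinJ τ)) (hfF : f ∈ F) : IsIntegral ℤ (f τ) := by
  classical
  set s := hF.toFinset
  set p : Polynomial (ℍ → ℂ) := ∏ g ∈ s, (.X - .C g) with hp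
  have hcoeff : ∀ i, p.coeff i ∈ integralExpansions N := fun i ↦ by
    have h : p ∈ Polynomial.liftsRing (integralExpansions N).subtype := by
      refine prod_mem fun g hg ↦ sub_mem ?_ ?_
      · exact (Polynomial.lifts_iff_liftsRing _ _).mp (Polynomial.X_mem_lifts _)
      · exact (Polynomial.lifts_iff_liftsRing _ _).mp
          (Polynomial.C_mem_lifts (integralExpansions N).subtype
            ⟨g, hmem g (hF.mem_toFinset.mp hg)⟩)
    obtain ⟨⟨x, hx⟩, h⟩ := (Polynomial.lifts_iff_coeff_lifts _).mp
      ((Polynomial.lifts_iff_liftsRing _ _).mpr h) i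
    rw [← h]
    exact hx
  have hinv : ∀ i, p.coeff i ∈ levelOneInvariants := fun i ↦
    coeff_prod_X_sub_C_mem_levelOneInvariants (fun f hf γ ↦
      hF.mem_toFinset.mpr (hstab f (hF.mem_toFinset.mp hf) γ)) i
  set q := p.map (Pi.evalRingHom (fun _ : ℍ ↦ ℂ) τ) with hq
  have hqi : ∀ i, IsIntegral ℤ (q.coeff i) := fun i ↦ by
    obtain ⟨K, P, h⟩ := exists_hasExpansion_neg (hcoeff i)
    obtain ⟨r, hr, -, -, hre⟩ := h.exists_polynomial (hinv i)
    have h1 : q.coeff i = p.coeff i τ := by rw [hq, Polynomial.coeff_map]; rfl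
    rw [h1, hre, Polynomial.eval_eq_sum_range]
    exact IsIntegral.sum _ fun j _ ↦ (hr j).mul (hτ.pow j)
  have hqe : q = ∏ g ∈ s, (.X - .C (g τ)) := by
    simp [hq, hp, Polynomial.map_prod]
  have hmonic : q.Monic := hqe ▸ Polynomial.monic_prod_of_monic _ _ fun g _ ↦
    Polynomial.monic_X_sub_C _
  have hroot : q.eval (f τ) = 0 := by
    rw [hqe, Polynomial.eval_prod]
    exact Finset.prod_eq_zero (hF.mem_toFinset.mpr hfF) (by simp)
  set A := integralClosure ℤ ℂ
  have hlift : q ∈ Polynomial.lifts (algebraMap A ℂ) :=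
    (Polynomial.lifts_iff_coeff_lifts _).mpr fun i ↦ ⟨⟨_, hqi i⟩, rfl⟩
  obtain ⟨r, hr, -, hrm⟩ := Polynomial.lifts_and_natDegree_eq_and_monic hlift hmonic
  have : IsIntegral A (f τ) := ⟨r, hrm, by rw [Polynomial.eval₂_eq_eval_map, hr, hroot]⟩
  exact isIntegral_trans (R := ℤ) (A := A) _ this

end

section

variable {m : ℕ} [NeZero m]

/-- An integral matrix of determinant `m` as a real invertible matrix. -/
noncomputable def fixedDetToGL (A : FixedDetMatrix (Fin 2) ℤ m) : GL (Fin 2) ℝ :=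
  .mkOfDetNeZero (A.1.map (Int.castRingHom ℝ)) (by
    rw [← RingHom.mapMatrix_apply, ← RingHom.map_det, A.2]
    simp [NeZero.ne m])

lemma coe_fixedDetToGL (A : FixedDetMatrix (Fin 2) ℤ m) :
    (fixedDetToGL A : Matrix (Fin 2) (Fin 2) ℝ) = A.1.map (Int.castRingHom ℝ) := rfl

lemma coe_fixedDetToGL_smul (A : FixedDetMatrix (Fin 2) ℤ m) (τ : ℍ) :
    (↑(fixedDetToGL A • τ) : ℂ) = (A.1 0 0 * τ + A.1 0 1) / (A.1 1 0 * τ + A.1 1 1) := by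
  rw [coe_smul_of_det_pos]
  · simp [num, denom, coe_fixedDetToGL]
  · have : (fixedDetToGL A).det.val = m := by
      rw [Matrix.GeneralLinearGroup.val_det_apply, coe_fixedDetToGL, ← RingHom.mapMatrix_apply,
        ← RingHom.map_det, A.2]
      simp
    rw [this]
    exact_mod_cast NeZero.pos m

lemma fixedDetToGL_smul_smul (γ : SL(2, ℤ)) (A : FixedDetMatrix (Fin 2) ℤ m) (τ : ℍ) :
    fixedDetToGL (γ • A) • τ = γ • fixedDetToGL A • τ := by
  have : fixedDetToGL (γ • A) = Matrix.SpecialLinearGroup.mapGL ℝ γ * fixedDetToGL A := by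
    refine Units.ext ?_
    rw [coe_fixedDetToGL, FixedDetMatrices.smul_coe, Matrix.map_mul]
    rfl
  rw [this, mul_smul]
  rfl

/-- Right multiplication of an integral matrix of determinant `m` by `γ`. -/
def fixedDetMul (A : FixedDetMatrix (Fin 2) ℤ m) (γ : SL(2, ℤ)) : FixedDetMatrix (Fin 2) ℤ m :=
  ⟨A.1 * γ, by rw [Matrix.det_mul, A.2, γ.det_coe, mul_one]⟩

lemma fixedDetToGL_fixedDetMul_smul (A : FixedDetMatrix (Fin 2) ℤ m) (γ : SL(2, ℤ)) (τ : ℍ) :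
    fixedDetToGL (fixedDetMul A γ) • τ = fixedDetToGL A • γ • τ := by
  have : fixedDetToGL (fixedDetMul A γ) =
      fixedDetToGL A * Matrix.SpecialLinearGroup.mapGL ℝ γ := by
    refine Units.ext ?_
    rw [coe_fixedDetToGL, fixedDetMul, Matrix.map_mul]
    rfl
  rw [this, mul_smul]
  rfl

/-- The function `τ ↦ j (A τ)`. -/
noncomputable def kleinJComp (A : FixedDetMatrix (Fin 2) ℤ m) (τ : ℍ) : ℂ :=
  kleinJ (fixedDetToGL A • τ)

lemma kleinJComp_smul_left (γ : SL(2, ℤ)) (A : FixedDetMatrix (Fin 2) ℤ m) :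
    kleinJComp (γ • A) = kleinJComp A := by
  ext τ
  rw [kleinJComp, fixedDetToGL_smul_smul, kleinJ_smul, kleinJComp]

lemma kleinJComp_eq_of_reps (A : FixedDetMatrix (Fin 2) ℤ m) :
    ∃ B ∈ FixedDetMatrices.reps (m : ℤ), kleinJComp A = kleinJComp B := by
  induction A using FixedDetMatrices.induction_on (Int.natCast_ne_zero.mpr (NeZero.ne m)) with
  | h0 A h1 h2 h3 h4 => exact ⟨A, ⟨h1, h2, h3, h4⟩, rfl⟩
  | hS B hB => rwa [kleinJComp_smul_left]
  | hT B hB => rwa [kleinJComp_smul_left]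

lemma finite_range_kleinJComp : (Set.range (kleinJComp (m := m))).Finite := by
  refine ((Set.toFinite (FixedDetMatrices.reps (m : ℤ))).image kleinJComp).subset ?_
  rintro _ ⟨A, rfl⟩
  obtain ⟨B, hB, h⟩ := kleinJComp_eq_of_reps A
  exact ⟨B, hB, h.symm⟩

lemma hasUnitExpansion_kleinJ {N : ℕ} [NeZero N] : HasUnitExpansion N (-N) kleinJ := by
  obtain ⟨P, hP, hP0⟩ := hasExpansion_kleinJ (N := N)
  exact ⟨P, hP, by simpa [hP0] using isIntegral_one, by simp [hP0]⟩

lemma exists_hasUnitExpansion_kleinJComp (A : FixedDetMatrix (Fin 2) ℤ m) :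
    ∃ a : ℕ, 0 < a ∧ HasUnitExpansion m (-(a ^ 2 : ℕ)) (kleinJComp A) := by
  obtain ⟨B, ⟨h10, h00, h01, h11⟩, h⟩ := kleinJComp_eq_of_reps A
  rw [h]
  have hdet : B.1 0 0 * B.1 1 1 = m := by
    simpa only [Matrix.det_fin_two, h10, mul_zero, sub_zero] using B.2
  have hm : (0 : ℤ) < m := by exact_mod_cast NeZero.pos m
  have hd : 0 < B.1 1 1 := by
    by_contra! hd
    nlinarith
  obtain ⟨a, ha⟩ := Int.eq_ofNat_of_zero_le h00.le
  obtain ⟨d, hd'⟩ := Int.eq_ofNat_of_zero_le hd.le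
  rw [ha] at h00 hdet
  rw [hd'] at hd hdet
  have hdet' : (a : ℂ) * d = m := by exact_mod_cast hdet
  have hd0 : (d : ℂ) ≠ 0 := by exact_mod_cast hd.ne'
  have hm0 : (m : ℂ) ≠ 0 := NeZero.ne _
  refine ⟨a, by exact_mod_cast h00, ?_⟩
  have := (hasUnitExpansion_kleinJ (N := 1)).comp (N := m) (σ := fun τ ↦ fixedDetToGL B • τ)
    (ζ := Complex.exp (2 * Real.pi * Complex.I * B.1 0 1 / d)) (n := d) (a := a ^ 2)
    (by exact_mod_cast hd.ne') ?_ (by have : 0 < a := by exact_mod_cast h00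
                                      positivity) fun τ ↦ ?_
  · rw [Nat.cast_one, mul_neg_one] at this
    exact this
  · rw [← Complex.exp_nat_mul, Complex.exp_eq_one_iff]
    exact ⟨B.1 0 1, by field_simp⟩
  · rw [Function.Periodic.qParam, Function.Periodic.qParam, ← Complex.exp_nat_mul,
      ← Complex.exp_add, coe_fixedDetToGL_smul, h10, ha, hd']
    congr 1
    push_cast
    rw [zero_mul, zero_add]
    rw [← hdet'] at hm0 ⊢
    have ha0 := left_ne_zero_of_mul hm0
    field_simp
    ring

/-- If an integral matrix of nonsquare determinant fixes `τ`, then `kleinJ τ` is integral. -/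
lemma isIntegral_kleinJ_of_smul_eq (hm : ¬ IsSquare m) (A : FixedDetMatrix (Fin 2) ℤ m) {τ : ℍ}
    (h : fixedDetToGL A • τ = τ) : IsIntegral ℤ (kleinJ τ) := by
  set s := (finite_range_kleinJComp (m := m)).toFinset
  have hs : ∀ f, f ∈ s ↔ ∃ A : FixedDetMatrix (Fin 2) ℤ m, kleinJComp A = f := fun f ↦
    (finite_range_kleinJComp (m := m)).mem_toFinset
  have hstab : ∀ f ∈ s, ∀ γ : SL(2, ℤ), (fun τ ↦ f (γ • τ)) ∈ s := fun f hf γ ↦ by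
    obtain ⟨A, rfl⟩ := (hs f).mp hf
    refine (hs _).mpr ⟨fixedDetMul A γ, ?_⟩
    ext τ
    rw [kleinJComp, fixedDetToGL_fixedDetMul_smul, kleinJComp]
  have hdiff : ∀ f ∈ s, ∃ k < 0, HasUnitExpansion m k (kleinJ - f) := fun f hf ↦ by
    obtain ⟨A, rfl⟩ := (hs f).mp hf
    obtain ⟨a, ha, hA⟩ := exists_hasUnitExpansion_kleinJComp A
    have hJ := hasUnitExpansion_kleinJ (N := m)
    have hm0 := NeZero.pos m
    rcases lt_trichotomy m (a ^ 2) with hlt | heq | hlt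
    · obtain ⟨P, hP, -⟩ := hJ
      refine ⟨_, ?_, neg_sub (kleinJComp A) kleinJ ▸
        (hA.sub_of_lt hP (neg_lt_neg (by exact_mod_cast hlt))).neg⟩
      exact neg_neg_of_pos (by positivity)
    · exact (hm ⟨a, heq.trans (sq a)⟩).elim
    · obtain ⟨P, hP, -⟩ := hA
      exact ⟨_, by simpa using hm0,
        hJ.sub_of_lt hP (neg_lt_neg (by exact_mod_cast hlt))⟩
  choose! k hk0 hk using hdiff
  have hAs : kleinJComp A ∈ s := (hs _).mpr ⟨A, rfl⟩
  refine isIntegral_kleinJ_of_eq_zero (HasUnitExpansion.prod s hk) ?_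
    (Finset.sum_neg hk0 ⟨_, hAs⟩) ?_
  · have : ∏ f ∈ s, (kleinJ - f) = (∏ f ∈ s, (.X - .C f) : Polynomial (ℍ → ℂ)).eval kleinJ := by
      simp [Polynomial.eval_prod]
    rw [this, Polynomial.eval_eq_sum_range]
    exact sum_mem fun i _ ↦ mul_mem (coeff_prod_X_sub_C_mem_levelOneInvariants hstab i)
      (pow_mem kleinJ_mem_levelOneInvariants i)
  · rw [Finset.prod_apply]
    refine Finset.prod_eq_zero hAs ?_
    rw [Pi.sub_apply, kleinJComp, h, sub_self]

/-- The values of the modular `j`-function at imaginary quadratic points are integral. -/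
theorem isIntegral_kleinJ_of_quadratic {τ : ℍ} {a b c : ℤ} (ha : a ≠ 0)
    (h : (a : ℂ) * τ ^ 2 + b * τ + c = 0) : IsIntegral ℤ (kleinJ τ) := by
  have hD : 0 < 4 * a * c - b ^ 2 := by
    have hre := congrArg Complex.re h
    have him := congrArg Complex.im h
    have ha' : (a : ℝ) ≠ 0 := by exact_mod_cast ha
    simp [sq] at hre him
    have hy := τ.im_pos
    have h1 : 2 * a * τ.re + b = 0 := by
      refine mul_right_cancel₀ hy.ne' ?_
      linear_combination him
    have h2 : (4 * a * c - b ^ 2 : ℝ) = 4 * a ^ 2 * τ.im ^ 2 := by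
      linear_combination 4 * a * hre - (b + 2 * a * τ.re) * h1
    have h3 : (0 : ℝ) < 4 * a * c - b ^ 2 := by rw [h2]; positivity
    exact_mod_cast h3
  set D := 4 * a * c - b ^ 2
  set n := D + |b|
  have hn : D ≤ 2 * n - b := by
    have := le_abs_self b
    have := abs_nonneg b
    omega
  have hdet : 4 * (n ^ 2 - b * n + a * c) = (2 * n - b) ^ 2 + D := by
    simp only [D]
    ring
  have hpos : 0 < n ^ 2 - b * n + a * c := by nlinarith
  obtain ⟨m, hm⟩ := Int.eq_ofNat_of_zero_le hpos.le
  have : NeZero m := ⟨by rintro rfl; simp [hm] at hpos⟩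
  have hsq : ¬ IsSquare m := by
    rintro ⟨r, rfl⟩
    push_cast at hm
    rw [hm] at hdet
    have h1 : 2 * n - b < 2 * r := by
      by_contra! hle
      nlinarith
    nlinarith
  obtain ⟨A, hA⟩ : ∃ A : FixedDetMatrix (Fin 2) ℤ m, A.1 = !![n - b, -c; a, n] := by
    refine ⟨⟨_, ?_⟩, rfl⟩
    rw [Matrix.det_fin_two_of, ← hm]
    ring
  refine isIntegral_kleinJ_of_smul_eq hsq A ?_
  ext
  rw [coe_fixedDetToGL_smul, hA]
  have hden : (a : ℂ) * τ + n ≠ 0 := fun h0 ↦ by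
    have := congrArg Complex.im h0
    simp [ha, τ.im_ne_zero] at this
  simp
  rw [div_eq_iff hden]
  linear_combination -h

end

section

/-- The infinite product `∏ (1 - qⁿ x)`. -/
noncomputable def qProd (q x : ℂ) : ℂ := ∏' n : ℕ, (1 - q ^ n * x)

section qProd

variable {q : ℂ} (hq : ‖q‖ < 1)
include hq

lemma summable_norm_neg_pow_mul (x : ℂ) : Summable fun n : ℕ ↦ ‖-(q ^ n * x)‖ := by
  simpa using (summable_geometric_of_lt_one (norm_nonneg _) hq).mul_right ‖x‖

lemma multipliable_one_sub_pow_mul (x : ℂ) : Multipliable fun n : ℕ ↦ 1 - q ^ n * x :=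
  multipliable_one_add_of_summable (f := fun n ↦ -(q ^ n * x)) (summable_norm_neg_pow_mul hq x)

lemma qProd_eq_mul (x : ℂ) : qProd q x = (1 - x) * qProd q (q * x) := by
  have h := tprod_eq_zero_mul' (f := fun n : ℕ ↦ 1 - q ^ n * x)
    (by simpa only [pow_succ, mul_assoc] using multipliable_one_sub_pow_mul hq (q * x))
  simpa only [qProd, pow_zero, one_mul, pow_succ, mul_assoc] using h

lemma qProd_eq_zero_iff (x : ℂ) : qProd q x = 0 ↔ ∃ n : ℕ, q ^ n * x = 1 := by
  constructor
  · contrapose!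
    exact fun h ↦ tprod_one_add_ne_zero_of_summable (f := fun n : ℕ ↦ -(q ^ n * x))
      (fun n ↦ by simpa [← sub_eq_add_neg, sub_eq_zero] using (h n).symm)
      (summable_norm_neg_pow_mul hq x)
  · rintro ⟨n, hn⟩
    exact tprod_of_exists_eq_zero ⟨n, by rw [hn, sub_self]⟩

lemma differentiable_qProd : Differentiable ℂ (qProd q) := by
  have h : HasProdLocallyUniformlyOn (fun (n : ℕ) x ↦ 1 - q ^ n * x) (qProd q) Set.univ := by
    simp_rw [sub_eq_add_neg]
    apply hasProdLocallyUniformlyOn_of_forall_compact isOpen_univ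
    intro K _ hcK
    obtain ⟨M, hM⟩ := hcK.isBounded.exists_norm_le
    have := ((summable_geometric_of_lt_one (norm_nonneg _) hq).mul_right
      M).hasProdUniformlyOn_nat_one_add (f := fun n x ↦ -(q ^ n * x))
      hcK (.of_forall fun n x hx ↦ ?_) (fun _ ↦ by fun_prop)
    · simpa only [qProd, sub_eq_add_neg] using! this
    · rw [norm_neg, norm_mul, norm_pow]
      exact mul_le_mul_of_nonneg_left (hM x hx) (by positivity)
  exact differentiableOn_univ.mp <| h.differentiableOn
    (.of_forall fun _ ↦ by simpa [Finset.prod_fn] using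
      DifferentiableOn.finsetProd (fun _ _ ↦ by fun_prop)) isOpen_univ

end qProd

lemma qParam_add (h : ℝ) (z w : ℂ) : 𝕢 h (z + w) = 𝕢 h z * 𝕢 h w := by
  simp only [Function.Periodic.qParam, ← Complex.exp_add]
  ring_nf

lemma qParam_neg (h : ℝ) (z : ℂ) : 𝕢 h (-z) = (𝕢 h z)⁻¹ := by
  simp only [Function.Periodic.qParam, ← Complex.exp_neg]
  ring_nf

lemma qParam_sub (h : ℝ) (z w : ℂ) : 𝕢 h (z - w) = 𝕢 h z / 𝕢 h w := by
  rw [sub_eq_add_neg, qParam_add, qParam_neg, div_eq_mul_inv]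

lemma qParam_int_mul (h : ℝ) (m : ℤ) (z : ℂ) : 𝕢 h (m * z) = 𝕢 h z ^ m := by
  simp only [Function.Periodic.qParam, ← Complex.exp_int_mul]
  ring_nf

lemma qParam_one_eq_one_iff (z : ℂ) : 𝕢 1 z = 1 ↔ ∃ m : ℤ, z = m := by
  rw [Function.Periodic.qParam, Complex.exp_eq_one_iff]
  refine exists_congr fun m ↦ ?_
  rw [Complex.ofReal_one, div_one, mul_comm (m : ℂ), mul_right_inj' Complex.two_pi_I_ne_zero]

lemma differentiable_qParam (h : ℝ) : Differentiable ℂ (𝕢 h) := by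
  unfold Function.Periodic.qParam
  fun_prop

/-- The period pair `(1, τ)`. -/
noncomputable def periodPair (τ : ℍ) : PeriodPair where
  ω₁ := 1
  ω₂ := τ
  indep := by
    rw [LinearIndependent.pair_iff]
    intro s t h
    have h2 := congrArg Complex.im h
    have h1 := congrArg Complex.re h
    simp [τ.im_ne_zero] at h1 h2
    exact ⟨by simpa [h2] using h1, h2⟩

lemma mem_periodPair_lattice {τ : ℍ} {z : ℂ} :
    z ∈ (periodPair τ).lattice ↔ ∃ m n : ℤ, m + n * (τ : ℂ) = z := by
  simp [PeriodPair.mem_lattice, periodPair]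

/-- A theta function for the lattice `ℤ + ℤτ`. -/
noncomputable def ellTheta (τ : ℍ) (z : ℂ) : ℂ :=
  qProd (𝕢 1 τ) (𝕢 1 z) * qProd (𝕢 1 τ) (𝕢 1 τ * (𝕢 1 z)⁻¹)

variable (τ : ℍ)

lemma norm_qParam_one_lt : ‖𝕢 1 τ‖ < 1 := by simpa using norm_qParam_lt (N := 1) τ

lemma ellTheta_eq (z : ℂ) : ellTheta τ z =
    (1 - 𝕢 1 z) * (qProd (𝕢 1 τ) (𝕢 1 τ * 𝕢 1 z) * qProd (𝕢 1 τ) (𝕢 1 τ * (𝕢 1 z)⁻¹)) := by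
  rw [ellTheta, qProd_eq_mul (norm_qParam_one_lt τ) (𝕢 1 z), mul_assoc]

lemma ellTheta_add_one (z : ℂ) : ellTheta τ (z + 1) = ellTheta τ z := by
  have : 𝕢 1 (1 : ℂ) = 1 := (qParam_one_eq_one_iff 1).mpr ⟨1, by simp⟩
  rw [ellTheta, qParam_add, this, mul_one, ellTheta]

lemma ellTheta_add_self (z : ℂ) : ellTheta τ (z + τ) = -(𝕢 1 z)⁻¹ * ellTheta τ z := by
  have h0 := Function.Periodic.qParam_ne_zero (h := 1) z
  have h1 := Function.Periodic.qParam_ne_zero (h := 1) (τ : ℂ)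
  rw [ellTheta, ellTheta_eq, qParam_add, mul_inv, mul_comm (𝕢 1 z) (𝕢 1 τ),
    mul_comm (𝕢 1 z)⁻¹, mul_inv_cancel_left₀ h1, qProd_eq_mul (norm_qParam_one_lt τ) (𝕢 1 z)⁻¹]
  field_simp
  ring

lemma ellTheta_eq_zero_iff (z : ℂ) : ellTheta τ z = 0 ↔ z ∈ (periodPair τ).lattice := by
  have h0 := Function.Periodic.qParam_ne_zero (h := 1) z
  have key : ∀ m : ℤ, 𝕢 1 τ ^ m * 𝕢 1 z = 1 ↔ ∃ k : ℤ, k + (-m : ℤ) * (τ : ℂ) = z := fun m ↦ by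
    rw [← qParam_int_mul, ← qParam_add, qParam_one_eq_one_iff]
    refine exists_congr fun k ↦ ⟨fun h ↦ ?_, fun h ↦ ?_⟩
    · rw [← h]; push_cast; ring
    · rw [← h]; push_cast; ring
  rw [ellTheta, mul_eq_zero, qProd_eq_zero_iff (norm_qParam_one_lt τ),
    qProd_eq_zero_iff (norm_qParam_one_lt τ), mem_periodPair_lattice, exists_comm]
  constructor
  · rintro (⟨n, hn⟩ | ⟨n, hn⟩)
    · exact ⟨_, (key n).mp (by exact_mod_cast hn)⟩
    · refine ⟨_, (key (-(n + 1 : ℕ))).mp ?_⟩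
      rw [← mul_assoc, ← pow_succ, mul_inv_eq_one₀ h0] at hn
      rw [zpow_neg, zpow_natCast, hn, inv_mul_cancel₀ h0]
  · rintro ⟨n, hn⟩
    rw [← neg_neg n] at hn
    replace hn := (key _).mpr hn
    obtain ⟨j, hj | hj⟩ := Int.eq_nat_or_neg (-n)
    · exact .inl ⟨j, by rwa [hj, zpow_natCast] at hn⟩
    · rw [hj, zpow_neg, zpow_natCast] at hn
      rcases j with _ | j
      · exact .inl ⟨0, by simpa using hn⟩
      · refine .inr ⟨j, ?_⟩
        rw [← mul_assoc, ← pow_succ, mul_inv_eq_one₀ h0]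
        rwa [inv_mul_eq_one₀ (pow_ne_zero _ (Function.Periodic.qParam_ne_zero _))] at hn

lemma differentiable_ellTheta : Differentiable ℂ (ellTheta τ) := by
  have h := differentiable_qProd (norm_qParam_one_lt τ)
  have h1 := differentiable_qParam 1
  exact (h.comp h1).mul (h.comp ((h1.inv fun z ↦ Function.Periodic.qParam_ne_zero z).const_mul _))

lemma deriv_ellTheta_zero_ne_zero : deriv (ellTheta τ) 0 ≠ 0 := by
  set R : ℂ → ℂ := fun z ↦
    qProd (𝕢 1 τ) (𝕢 1 τ * 𝕢 1 z) * qProd (𝕢 1 τ) (𝕢 1 τ * (𝕢 1 z)⁻¹) with hR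
  have h := differentiable_qProd (norm_qParam_one_lt τ)
  have h1 := differentiable_qParam 1
  have hRd : Differentiable ℂ R := (h.comp (h1.const_mul _)).mul
    (h.comp ((h1.inv fun z ↦ Function.Periodic.qParam_ne_zero z).const_mul _))
  have hq0 : 𝕢 1 (0 : ℂ) = 1 := (qParam_one_eq_one_iff 0).mpr ⟨0, by simp⟩
  have hq1 : HasDerivAt (𝕢 1) (2 * Real.pi * Complex.I) 0 := by
    have := ((hasDerivAt_id (0 : ℂ)).const_mul (2 * Real.pi * Complex.I)).cexp
    have h4 : 𝕢 1 = fun z ↦ cexp (2 * Real.pi * Complex.I * id z) := by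
      ext z; simp [Function.Periodic.qParam]
    rw [h4]
    simpa using! this
  have h2 : HasDerivAt (ellTheta τ) ((-(2 * Real.pi * Complex.I)) * R 0 + (1 - 𝕢 1 (0 : ℂ)) * deriv R 0) 0 := by
    rw [show ellTheta τ = fun z ↦ (1 - 𝕢 1 z) * R z from funext (ellTheta_eq τ)]
    exact (hq1.const_sub 1).mul (hRd 0).hasDerivAt
  rw [h2.deriv, hq0, sub_self, zero_mul, add_zero, hR]
  have h3 : qProd (𝕢 1 τ) (𝕢 1 τ) ≠ 0 := by
    rw [Ne, qProd_eq_zero_iff (norm_qParam_one_lt τ)]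
    rintro ⟨n, hn⟩
    have h4 : ‖𝕢 1 τ ^ (n + 1)‖ < 1 := by
      rw [norm_pow]
      exact pow_lt_one₀ (norm_nonneg _) (norm_qParam_one_lt τ) n.succ_ne_zero
    rw [pow_succ, hn, norm_one] at h4
    exact lt_irrefl _ h4
  simp [hq0, h3]

lemma isTheta_ellTheta : (periodPair τ).IsTheta (ellTheta τ) where
  differentiable := differentiable_ellTheta τ
  eq_zero_iff := ellTheta_eq_zero_iff τ
  deriv_ne_zero := by
    have hgen : ∀ (l : ℂ) (ε : ℂ → ℂ), Differentiable ℂ ε → (∀ z, ε z ≠ 0) →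
        (∀ z, ellTheta τ (z + l) = ε z * ellTheta τ z) →
        Function.Periodic (fun z ↦ ellTheta τ z = 0 ∧ deriv (ellTheta τ) z ≠ 0) l := by
      intro l ε hεd hε0 hε z
      have h1 : ellTheta τ (z + l) = 0 ↔ ellTheta τ z = 0 := by
        rw [hε, mul_eq_zero, or_iff_right (hε0 z)]
      have h2 : deriv (ellTheta τ) (z + l) =
          deriv ε z * ellTheta τ z + ε z * deriv (ellTheta τ) z := by
        rw [← deriv_comp_add_const, funext hε]
        exact ((hεd z).hasDerivAt.mul (differentiable_ellTheta τ z).hasDerivAt).deriv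
      simp only [eq_iff_iff, h1]
      refine and_congr_right fun h3 ↦ ?_
      rw [h2, h3, mul_zero, zero_add, mul_ne_zero_iff, and_iff_right (hε0 z)]
    have p1 := hgen 1 (fun _ ↦ 1) (by fun_prop) (by simp) fun z ↦ by
      rw [ellTheta_add_one, one_mul]
    have p2 := hgen τ (fun z ↦ -(𝕢 1 z)⁻¹)
      ((differentiable_qParam 1).inv fun z ↦ Function.Periodic.qParam_ne_zero z).neg
      (fun z ↦ neg_ne_zero.mpr (inv_ne_zero (Function.Periodic.qParam_ne_zero z)))
      (ellTheta_add_self τ)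
    intro z hz
    obtain ⟨m, n, rfl⟩ := mem_periodPair_lattice.mp hz
    have := ((p1.int_mul m).add_period (p2.int_mul n)) 0
    rw [zero_add, mul_one] at this
    exact (this.mpr ⟨(ellTheta_eq_zero_iff τ 0).mpr (zero_mem _), deriv_ellTheta_zero_ne_zero τ⟩).2
  exists_factor := by
    rintro l (rfl | rfl)
    · exact ⟨fun _ ↦ 1, by simp, fun z ↦ by rw [one_mul]; exact ellTheta_add_one τ z, by simp⟩
    · refine ⟨fun z ↦ -(𝕢 1 z)⁻¹,
        fun z ↦ neg_ne_zero.mpr (inv_ne_zero (Function.Periodic.qParam_ne_zero z)),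
        ellTheta_add_self τ, fun z w ↦ ?_⟩
      have h0 := Function.Periodic.qParam_ne_zero (h := 1) z
      have h1 := Function.Periodic.qParam_ne_zero (h := 1) w
      simp only [qParam_add, qParam_sub]
      field_simp

lemma hasSum_weierstrassP_periodPair (z : ℂ) : HasSum (fun p : ℤ × ℤ ↦
    1 / (z - (p.1 + p.2 * (τ : ℂ))) ^ 2 - 1 / (p.1 + p.2 * (τ : ℂ)) ^ 2)
    ((periodPair τ).weierstrassP z) := by
  have h := ((periodPair τ).latticeEquivProd.symm.toEquiv.hasSum_iff).mpr
    ((periodPair τ).hasSum_weierstrassP z)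
  refine h.congr_fun fun p ↦ ?_
  have := (periodPair τ).latticeEquiv_symm_apply p
  simp only [periodPair, mul_one] at this
  rw [← this]
  rfl

lemma wp_eq_weierstrassP (z : ℂ) : wp τ z = (periodPair τ).weierstrassP z := by
  have h := hasSum_weierstrassP_periodPair τ z
  set t : ℤ × ℤ → ℂ := fun p ↦
    1 / (z - (p.1 + p.2 * (τ : ℂ))) ^ 2 - 1 / (p.1 + p.2 * (τ : ℂ)) ^ 2 with ht
  have h1 := tsum_subtype {p : ℤ × ℤ | p ≠ 0} t
  rw [← h.tsum_eq, h.summable.tsum_eq_add_tsum_ite 0, wp]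
  congr 1
  · simp [ht]
  · refine h1.trans (tsum_congr fun p ↦ ?_)
    by_cases hp : p = 0 <;> simp [hp]

end

section

/-- The summands of `wp`, with the lattice point `0` contributing `1 / z ^ 2`. -/
lemma hasSum_wp (τ : ℍ) (z : ℂ) : HasSum (fun p : ℤ × ℤ ↦
    1 / (z - (p.1 + p.2 * (τ : ℂ))) ^ 2 - 1 / (p.1 + p.2 * (τ : ℂ)) ^ 2) (wp τ z) := by
  rw [wp_eq_weierstrassP]
  exact hasSum_weierstrassP_periodPair τ z

lemma wp_smul (γ : SL(2, ℤ)) (τ : ℍ) (z : ℂ) :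
    wp (γ • τ : ℍ) z = (γ 1 0 * τ + γ 1 1 : ℂ) ^ 2 * wp τ ((γ 1 0 * τ + γ 1 1) * z) := by
  have hdet : γ 0 0 * γ 1 1 - γ 0 1 * γ 1 0 = 1 := by
    rw [← Matrix.det_fin_two, γ.det_coe]
  have hd : (γ 1 0 * τ + γ 1 1 : ℂ) ≠ 0 := by
    have := denom_ne_zero (γ : GL (Fin 2) ℝ) τ
    simpa [denom] using! this
  have hco : ((γ • τ : ℍ) : ℂ) = (γ 0 0 * τ + γ 0 1) / (γ 1 0 * τ + γ 1 1) := by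
    rw [specialLinearGroup_apply]
    simp
  let e : ℤ × ℤ ≃ ℤ × ℤ :=
    { toFun p := (γ 1 1 * p.1 + γ 0 1 * p.2, γ 1 0 * p.1 + γ 0 0 * p.2)
      invFun p := (γ 0 0 * p.1 - γ 0 1 * p.2, - γ 1 0 * p.1 + γ 1 1 * p.2)
      left_inv p := by
        ext
        · linear_combination p.1 * hdet
        · linear_combination p.2 * hdet
      right_inv p := by
        ext
        · linear_combination p.1 * hdet
        · linear_combination p.2 * hdet }
  have h := ((e.hasSum_iff).mpr (hasSum_wp τ ((γ 1 0 * τ + γ 1 1) * z))).mul_left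
    ((γ 1 0 * τ + γ 1 1 : ℂ) ^ 2)
  refine (hasSum_wp (γ • τ) z).unique (h.congr_fun fun p ↦ ?_)
  have he : ((e p).1 + (e p).2 * (τ : ℂ)) =
      (γ 1 0 * τ + γ 1 1) * (p.1 + p.2 * ((γ • τ : ℍ) : ℂ)) := by
    rw [hco]
    simp only [e, Equiv.coe_fn_mk]
    push_cast
    field_simp
    ring
  have key (x : ℂ) : (γ 1 0 * τ + γ 1 1 : ℂ) ^ 2 * (1 / ((γ 1 0 * τ + γ 1 1) * x) ^ 2) =
      1 / x ^ 2 := by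
    rw [mul_pow, mul_one_div, ← mul_div_mul_left 1 (x ^ 2) (pow_ne_zero 2 hd), mul_one]
  simp only [Function.comp, he]
  rw [← mul_sub, mul_sub (_ ^ 2), key, key]

/-- The ratio of differences of `℘`-values at the multiples of the torsion point
`(c₁ + c₂τ) / N`. -/
noncomputable def torsionRatio (N : ℕ) (a₁ a₂ a₃ : ℤ) (c : ℤ × ℤ) (τ : ℍ) : ℂ :=
  (wp τ (a₁ * ((c.1 + c.2 * τ) / N)) - wp τ (a₃ * ((c.1 + c.2 * τ) / N))) /
    (wp τ (a₂ * ((c.1 + c.2 * τ) / N)) - wp τ (a₃ * ((c.1 + c.2 * τ) / N)))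

lemma Wfun_eq_torsionRatio (N : ℕ) (a₁ a₂ a₃ : ℤ) (τ : ℍ) :
    Wfun N a₁ a₂ a₃ τ = torsionRatio N a₁ a₂ a₃ (1, 0) τ := by
  simp [Wfun, torsionRatio, div_eq_mul_inv]

lemma torsionRatio_smul (N : ℕ) (a₁ a₂ a₃ : ℤ) (c : ℤ × ℤ) (γ : SL(2, ℤ)) (τ : ℍ) :
    torsionRatio N a₁ a₂ a₃ c (γ • τ) =
      torsionRatio N a₁ a₂ a₃ (c.1 * γ 1 1 + c.2 * γ 0 1, c.1 * γ 1 0 + c.2 * γ 0 0) τ := by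
  have hd : (γ 1 0 * τ + γ 1 1 : ℂ) ≠ 0 := by
    have := denom_ne_zero (γ : GL (Fin 2) ℝ) τ
    simpa [denom] using! this
  have hco : ((γ • τ : ℍ) : ℂ) = (γ 0 0 * τ + γ 0 1) / (γ 1 0 * τ + γ 1 1) := by
    rw [specialLinearGroup_apply]
    simp
  have h (a : ℤ) : (γ 1 0 * τ + γ 1 1 : ℂ) * (a * ((c.1 + c.2 * ((γ • τ : ℍ) : ℂ)) / N)) =
      a * (((c.1 * γ 1 1 + c.2 * γ 0 1 : ℤ) + (c.1 * γ 1 0 + c.2 * γ 0 0 : ℤ) * τ) / N) := by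
    rw [hco]
    push_cast
    field_simp
    ring
  simp only [torsionRatio, wp_smul, h, ← mul_sub]
  exact mul_div_mul_left _ _ (pow_ne_zero 2 hd)

variable {N : ℕ} [NeZero N]

lemma torsionRatio_eq_of_modEq {a₁ a₂ a₃ : ℤ} {c d : ℤ × ℤ} (h₁ : (N : ℤ) ∣ c.1 - d.1)
    (h₂ : (N : ℤ) ∣ c.2 - d.2) : torsionRatio N a₁ a₂ a₃ c = torsionRatio N a₁ a₂ a₃ d := by
  obtain ⟨m, hm⟩ := h₁
  obtain ⟨n, hn⟩ := h₂
  ext τ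
  have hN : (N : ℂ) ≠ 0 := NeZero.ne _
  have h (a : ℤ) : wp τ (a * ((c.1 + c.2 * τ) / N)) = wp τ (a * ((d.1 + d.2 * τ) / N)) := by
    have hl : ((a * m : ℤ) + (a * n : ℤ) * (τ : ℂ)) ∈ (periodPair τ).lattice :=
      mem_periodPair_lattice.mpr ⟨_, _, rfl⟩
    rw [wp_eq_weierstrassP, wp_eq_weierstrassP, ← (periodPair τ).weierstrassP_add_coe (a * ((d.1 + d.2 * τ) / N)) ⟨_, hl⟩]
    congr 1
    rw [sub_eq_iff_eq_add.mp hm, sub_eq_iff_eq_add.mp hn]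
    push_cast
    field_simp
    ring
  simp only [torsionRatio, h]

lemma mul_div_notMem_lattice {a : ℤ} (ha : IsCoprime a N) {c : ℤ × ℤ}
    (hc : ¬ ((N : ℤ) ∣ c.1 ∧ (N : ℤ) ∣ c.2)) (τ : ℍ) :
    (a : ℂ) * ((c.1 + c.2 * τ) / N) ∉ (periodPair τ).lattice := by
  rintro h
  obtain ⟨m, n, h⟩ := mem_periodPair_lattice.mp h
  have hN : (N : ℂ) ≠ 0 := NeZero.ne _
  have h1 : ((N * m - a * c.1 : ℤ) : ℂ) + (N * n - a * c.2 : ℤ) * τ = 0 := by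
    field_simp at h
    push_cast
    linear_combination h
  have h2 := congrArg Complex.im h1
  have h3 := congrArg Complex.re h1
  simp only [Complex.add_im, Complex.intCast_im, Complex.mul_im, Complex.intCast_re, coe_im,
    zero_mul, zero_add, add_zero, Complex.zero_im, mul_eq_zero, τ.im_ne_zero, or_false,
    Int.cast_eq_zero] at h2
  rw [h2] at h3
  simp only [Int.cast_zero, zero_mul, add_zero, Complex.intCast_re, Complex.zero_re,
    Int.cast_eq_zero] at h3
  exact hc ⟨ha.symm.dvd_of_dvd_mul_left ⟨m, by linarith⟩,
    ha.symm.dvd_of_dvd_mul_left ⟨n, by linarith⟩⟩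

end

section

lemma isIntegral_of_pow_eq_one {ξ : ℂ} {N : ℕ} (hN : N ≠ 0) (hξ : ξ ^ N = 1) : IsIntegral ℤ ξ :=
  IsIntegral.of_pow (Nat.pos_of_ne_zero hN) (hξ ▸ isIntegral_one)

lemma exists_nat_zpow_eq {ξ : ℂ} {N : ℕ} (hN : N ≠ 0) (hξ : ξ ^ N = 1) (a : ℤ) :
    ∃ n : ℕ, ξ ^ a = ξ ^ n := by
  have h0 : ξ ≠ 0 := by rintro rfl; simp [hN] at hξ
  refine ⟨(a % N).toNat, ?_⟩
  rw [← zpow_natCast, Int.toNat_of_nonneg (Int.emod_nonneg _ (by exact_mod_cast hN))]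
  conv_lhs => rw [← Int.emod_add_mul_ediv a N, zpow_add₀ h0, zpow_mul, zpow_natCast, hξ, one_zpow,
    mul_one]

lemma isIntegral_one_sub_zpow_div {ξ : ℂ} {N : ℕ} (hN : N ≠ 0) (hξ : ξ ^ N = 1) (a : ℤ) :
    IsIntegral ℤ ((1 - ξ ^ a) / (1 - ξ)) := by
  obtain ⟨n, hn⟩ := exists_nat_zpow_eq hN hξ a
  by_cases h1 : ξ = 1
  · simpa [h1] using isIntegral_zero
  rw [hn, ← neg_div_neg_eq, neg_sub, neg_sub, ← geom_sum_eq h1]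
  exact IsIntegral.sum _ fun i _ ↦ (isIntegral_of_pow_eq_one hN hξ).pow i

/-- Quotients of cyclotomic numbers `1 - ξ`, `1 - ξ ^ a` are units. -/
lemma isIntegral_one_sub_div_one_sub_zpow {ξ : ℂ} {N : ℕ} (hN : N ≠ 0) (hξ : ξ ^ N = 1) {a : ℤ}
    (ha : IsCoprime a N) : IsIntegral ℤ ((1 - ξ) / (1 - ξ ^ a)) := by
  obtain ⟨m, n, hmn⟩ := ha
  have h0 : ξ ≠ 0 := by rintro rfl; simp [hN] at hξ
  have h1 : (ξ ^ a) ^ N = 1 := by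
    rw [← zpow_natCast, ← zpow_mul, mul_comm, zpow_mul, zpow_natCast, hξ, one_zpow]
  have h2 : (ξ ^ a) ^ m = ξ := by
    rw [← zpow_mul, show a * m = 1 + N * (-n) by linarith, zpow_add₀ h0, zpow_mul, zpow_natCast,
      hξ, one_zpow, mul_one, zpow_one]
  simpa only [h2] using isIntegral_one_sub_zpow_div hN h1 m

variable {N : ℕ} [NeZero N]

lemma qParam_intCast_pow (b : ℤ) : 𝕢 N (b : ℂ) ^ N = 1 := by
  have hN : (N : ℂ) ≠ 0 := NeZero.ne _
  have h : 𝕢 N ((N : ℤ) * (b : ℂ)) = 1 := by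
    rw [Function.Periodic.qParam, Complex.exp_eq_one_iff]
    exact ⟨b, by push_cast; field_simp⟩
  rwa [qParam_int_mul, zpow_natCast] at h

lemma qParam_intCast_eq_one_iff (b : ℤ) : 𝕢 N (b : ℂ) = 1 ↔ (N : ℤ) ∣ b := by
  have hN : (N : ℂ) ≠ 0 := NeZero.ne _
  rw [Function.Periodic.qParam, Complex.exp_eq_one_iff]
  refine exists_congr fun m ↦ ?_
  rw [mul_comm (m : ℂ), mul_div_assoc, mul_right_inj' Complex.two_pi_I_ne_zero]
  push_cast
  rw [div_eq_iff hN, mul_comm (m : ℂ)]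
  norm_cast

omit [NeZero N] in
lemma HasUnitExpansion.zpow {c : ℂ} (hc : IsIntegral ℤ c) (hcu : IsIntegral ℤ c⁻¹) (h0 : c ≠ 0)
    (m : ℤ) : HasUnitExpansion N m (fun τ ↦ c * 𝕢 N τ ^ m) := by
  obtain ⟨P, hP, hPu⟩ := HasUnitExpansion.const (N := N) hc hcu h0
  refine ⟨P, ⟨hP.1, fun τ ↦ ?_⟩, hPu⟩
  rw [mul_comm, show c = _ from hP.2 τ, zpow_zero, one_mul]

lemma hasUnitExpansion_qProd {ξ : ℂ} (hξ : ξ ^ N = 1) {r : ℕ} (hr : 0 < r) :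
    HasUnitExpansion N 0 (fun τ ↦ qProd (𝕢 1 τ) (ξ * 𝕢 N τ ^ r)) := by
  have hN := NeZero.pos N
  obtain ⟨Q, hQ, hQ0, hQs⟩ := PowerSeries.IsAdmissible.exists_tprod (c := fun _ ↦ -ξ)
    (e := fun i ↦ N * i + r) (fun _ ↦ (isIntegral_of_pow_eq_one hN.ne' hξ).neg)
    (fun _ ↦ by rw [norm_neg, Complex.norm_eq_one_of_pow_eq_one hξ hN.ne'])
    (fun i ↦ by nlinarith)
  refine ⟨Q, ⟨hQ, fun τ ↦ ?_⟩, by simp [hQ0, isIntegral_one], by simp [hQ0]⟩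
  rw [zpow_zero, one_mul, hQs _ (norm_qParam_lt τ)]
  refine tprod_congr fun n ↦ ?_
  rw [← qParam_pow_eq (N := N), pow_add, pow_mul]
  ring

omit [NeZero N] in
lemma qParam_one_div (z : ℂ) : 𝕢 1 (z / N) = 𝕢 N z := by
  simp only [Function.Periodic.qParam, Complex.ofReal_one, div_one, mul_div_assoc,
    Complex.ofReal_natCast]

omit [NeZero N] in
lemma qParam_one_torsion (b c : ℤ) (τ : ℍ) :
    𝕢 1 ((b + c * τ : ℂ) / N) = 𝕢 N (b : ℂ) * 𝕢 N τ ^ c := by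
  rw [qParam_one_div, qParam_add, qParam_int_mul]

lemma qParam_intCast_isIntegral (b : ℤ) : IsIntegral ℤ (𝕢 N (b : ℂ)) :=
  isIntegral_of_pow_eq_one (NeZero.ne N) (qParam_intCast_pow b)

lemma qParam_intCast_inv_isIntegral (b : ℤ) : IsIntegral ℤ (𝕢 N (b : ℂ))⁻¹ :=
  isIntegral_of_pow_eq_one (NeZero.ne N) (by rw [inv_pow, qParam_intCast_pow, inv_one])

lemma exists_hasUnitExpansion_ellTheta_periodic (κ : ℂ) (b : ℤ) : Function.Periodic (fun c : ℤ ↦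
    ∃ k, HasUnitExpansion N k fun τ ↦ ellTheta τ ((b + c * τ) / N) / κ) N := by
  intro c
  have hN : (N : ℂ) ≠ 0 := NeZero.ne _
  have h0 := Function.Periodic.qParam_ne_zero (h := N) (b : ℂ)
  have hx (τ : ℍ) := Function.Periodic.qParam_ne_zero (h := N) (τ : ℂ)
  have h (τ : ℍ) : ellTheta τ ((b + (c + N : ℤ) * τ) / N) =
      -(𝕢 N (b : ℂ))⁻¹ * 𝕢 N τ ^ (-c) * ellTheta τ ((b + c * τ) / N) := by
    have h1 : ((b + (c + N : ℤ) * τ) / N : ℂ) = (b + c * τ) / N + τ := by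
      push_cast
      field_simp
      ring
    rw [h1, ellTheta_add_self, qParam_one_torsion, mul_inv, zpow_neg, neg_mul, neg_mul, neg_mul]
  refine propext ⟨fun ⟨k, hk⟩ ↦ ⟨c + k, ?_⟩, fun ⟨k, hk⟩ ↦ ⟨-c + k, ?_⟩⟩
  · convert (HasUnitExpansion.zpow (N := N) (c := -𝕢 N (b : ℂ)) (qParam_intCast_isIntegral b).neg
      (by rw [inv_neg]; exact (qParam_intCast_inv_isIntegral b).neg) (neg_ne_zero.mpr h0) c).mul hk
      using 1
    ext τ
    have := hx τ
    rw [Pi.mul_apply, h, zpow_neg]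
    field_simp
  · convert (HasUnitExpansion.zpow (N := N) (c := -(𝕢 N (b : ℂ))⁻¹)
      (qParam_intCast_inv_isIntegral b).neg
      (by rw [inv_neg, inv_inv]; exact (qParam_intCast_isIntegral b).neg)
      (neg_ne_zero.mpr (inv_ne_zero h0)) (-c)).mul hk using 1
    ext τ
    rw [Pi.mul_apply, h, mul_div_assoc]

lemma exists_hasUnitExpansion_ellTheta {c : ℤ × ℤ} (hc : ¬ ((N : ℤ) ∣ c.1 ∧ (N : ℤ) ∣ c.2)) :
    ∃ κ : ℂ, κ ≠ 0 ∧ ∀ a : ℤ, IsCoprime a N →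
      ∃ k, HasUnitExpansion N k fun τ ↦ ellTheta τ (a * ((c.1 + c.2 * τ) / N)) / κ := by
  have hN := NeZero.pos N
  have hmul (a : ℤ) (τ : ℍ) : (a * ((c.1 + c.2 * τ) / N) : ℂ) =
      ((a * c.1 : ℤ) + (a * c.2 : ℤ) * τ) / N := by push_cast; ring
  have hred (κ : ℂ) (a : ℤ) : (∃ k, HasUnitExpansion N k fun τ ↦
      ellTheta τ (a * ((c.1 + c.2 * τ) / N)) / κ) ↔ ∃ k, HasUnitExpansion N k fun τ ↦
        ellTheta τ (((a * c.1 : ℤ) + (a * c.2 % N : ℤ) * τ) / N) / κ := by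
    simp only [hmul]
    have := ((exists_hasUnitExpansion_ellTheta_periodic (N := N) κ (a * c.1)).int_mul
      (a * c.2 / N)) (a * c.2 % N)
    rw [← this]
    simp only [mul_comm (a * c.2 / N) (N : ℤ), Int.emod_add_mul_ediv, Int.cast_id]
  simp only [hred]
  have hinv (b : ℤ) : (𝕢 N (b : ℂ))⁻¹ ^ N = 1 := by rw [inv_pow, qParam_intCast_pow, inv_one]
  by_cases h2 : (N : ℤ) ∣ c.2
  · have h1 : ¬ (N : ℤ) ∣ c.1 := fun h1 ↦ hc ⟨h1, h2⟩
    set ξ := 𝕢 N (c.1 : ℂ) with hξ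
    have hξ1 : ∀ {a : ℤ}, IsCoprime a N → 1 - ξ ^ a ≠ 0 := fun {a} ha ↦ by
      rw [sub_ne_zero, hξ, ← qParam_int_mul, ne_comm, ← Int.cast_mul, Ne, qParam_intCast_eq_one_iff]
      exact mt ha.symm.dvd_of_dvd_mul_left h1
    have hξ0 : 1 - ξ ≠ 0 := by simpa using hξ1 isCoprime_one_left
    refine ⟨1 - ξ, hξ0, fun a ha ↦ ⟨0 + 0 + 0, ?_⟩⟩
    have hη : 𝕢 N ((a * c.1 : ℤ) : ℂ) = ξ ^ a := by rw [hξ, ← qParam_int_mul]; push_cast; rfl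
    convert ((HasUnitExpansion.const (N := N)
      (isIntegral_one_sub_zpow_div hN.ne' (qParam_intCast_pow c.1) a)
      (by rw [inv_div]; exact isIntegral_one_sub_div_one_sub_zpow hN.ne' (qParam_intCast_pow c.1) ha)
      (div_ne_zero (hξ1 ha) hξ0)).mul
      (hasUnitExpansion_qProd (qParam_intCast_pow (a * c.1)) hN)).mul
      (hasUnitExpansion_qProd (hinv (a * c.1)) hN) using 1
    ext τ
    rw [Int.emod_eq_zero_of_dvd (h2.mul_left a), ellTheta_eq, qParam_one_torsion, zpow_zero,
      mul_one, Pi.mul_apply, Pi.mul_apply, qParam_pow_eq, hη, ← hξ]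
    ring_nf
  · refine ⟨1, one_ne_zero, fun a ha ↦ ⟨0 + 0, ?_⟩⟩
    have hr0 : a * c.2 % N ≠ 0 := fun h ↦
      h2 (ha.symm.dvd_of_dvd_mul_left (Int.dvd_of_emod_eq_zero h))
    have hr1 := Int.emod_nonneg (a * c.2) (b := N) (by exact_mod_cast hN.ne')
    have hr2 := Int.emod_lt_of_pos (a * c.2) (b := N) (by exact_mod_cast hN)
    obtain ⟨r, hr⟩ := Int.eq_ofNat_of_zero_le hr1
    rw [hr] at hr0 hr2 ⊢
    convert (hasUnitExpansion_qProd (qParam_intCast_pow (N := N) (a * c.1)) (r := r) (by omega)).mul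
      (hasUnitExpansion_qProd (hinv (a * c.1)) (r := N - r) (by omega)) using 1
    ext τ
    have hx := Function.Periodic.qParam_ne_zero (h := N) (τ : ℂ)
    rw [div_one, ellTheta, qParam_one_torsion, Pi.mul_apply, zpow_natCast]
    congr 2
    rw [← qParam_pow_eq (N := N), mul_inv, pow_sub₀ _ hx (by omega)]
    ring

lemma exists_hasUnitExpansion_torsionRatio (hN : Odd N) {a₁ a₂ a₃ : ℤ} (h₁ : IsCoprime a₁ N)
    (h₂ : IsCoprime a₂ N) (h₃ : IsCoprime a₃ N) (hs₁ : IsCoprime (a₁ - a₃) N)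
    (hp₁ : IsCoprime (a₁ + a₃) N) (hs₂ : IsCoprime (a₂ - a₃) N) (hp₂ : IsCoprime (a₂ + a₃) N)
    {c : ℤ × ℤ} (hc : ¬ ((N : ℤ) ∣ c.1 ∧ (N : ℤ) ∣ c.2)) :
    ∃ k, HasUnitExpansion N k (torsionRatio N a₁ a₂ a₃ c) := by
  obtain ⟨κ, hκ, h⟩ := exists_hasUnitExpansion_ellTheta hc
  set T : ℤ → ℍ → ℂ := fun a τ ↦ ellTheta τ (a * ((c.1 + c.2 * τ) / N)) / κ with hT
  have hT0 (a : ℤ) (ha : IsCoprime a N) (τ : ℍ) : T a τ ≠ 0 :=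
    div_ne_zero (mt (ellTheta_eq_zero_iff τ _).mp (mul_div_notMem_lattice ha hc τ)) hκ
  have h2 : IsCoprime (2 * a₃) N := by
    refine IsCoprime.mul_left ?_ h₃
    obtain ⟨m, rfl⟩ := hN
    exact ⟨-m, 1, by push_cast; ring⟩
  have key : torsionRatio N a₁ a₂ a₃ c = T (a₁ + a₃) * T (a₁ - a₃) * (T (a₂ + a₃))⁻¹ *
      (T (a₂ - a₃))⁻¹ * T a₂ * T a₂ * (T a₁)⁻¹ * (T a₁)⁻¹ := by
    ext τ
    set z : ℂ := (c.1 + c.2 * τ) / N with hz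
    have hw : 2 * ((a₃ : ℂ) * z) ∉ (periodPair τ).lattice := by
      have := mul_div_notMem_lattice h2 hc τ
      rwa [Int.cast_mul, mul_assoc] at this
    obtain ⟨C, hC0, hC⟩ := (isTheta_ellTheta τ).exists_weierstrassP_sub_mul_sq hw
    have hdiff (a : ℤ) (ha : IsCoprime a N) : wp τ (a * z) - wp τ (a₃ * z) =
        C * (T (a + a₃) τ * T (a - a₃) τ) / T a τ ^ 2 := by
      have h1 := hC (a * z) (mul_div_notMem_lattice ha hc τ)
      have hadd : ((a + a₃ : ℤ) : ℂ) * z = a * z + a₃ * z := by push_cast; ring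
      have hsub : ((a - a₃ : ℤ) : ℂ) * z = a * z - a₃ * z := by push_cast; ring
      have hTz (b : ℤ) : T b τ = ellTheta τ (b * z) / κ := rfl
      rw [eq_div_iff (pow_ne_zero 2 (hT0 a ha τ)), wp_eq_weierstrassP, wp_eq_weierstrassP, hTz, hTz,
        hTz, hadd, hsub]
      linear_combination h1 / κ ^ 2
    have e1 := hT0 _ h₁ τ
    have e2 := hT0 _ h₂ τ
    have e3 := hT0 _ hs₂ τ
    have e4 := hT0 _ hp₂ τ
    simp only [torsionRatio, ← hz, hdiff _ h₁, hdiff _ h₂, Pi.mul_apply, Pi.inv_apply]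
    field_simp
  obtain ⟨k1, H1⟩ := h _ hp₁
  obtain ⟨k2, H2⟩ := h _ hs₁
  obtain ⟨k3, H3⟩ := h _ hp₂
  obtain ⟨k4, H4⟩ := h _ hs₂
  obtain ⟨k5, H5⟩ := h _ h₂
  obtain ⟨k6, H6⟩ := h _ h₁
  rw [key]
  exact ⟨_, ((((((H1.mul H2).mul (H3.inv (hT0 _ hp₂))).mul (H4.inv (hT0 _ hs₂))).mul H5).mul
    H5).mul (H6.inv (hT0 _ h₁))).mul (H6.inv (hT0 _ h₁))⟩

end

lemma exists_int_quadratic {α : ℂ} (halg : IsIntegral ℚ α) (hdeg : (minpoly ℚ α).natDegree = 2) :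
    ∃ a b c : ℤ, a ≠ 0 ∧ (a : ℂ) * α ^ 2 + b * α + c = 0 := by
  have h := minpoly.aeval ℚ α
  have hlead : (minpoly ℚ α).coeff 2 = 1 := hdeg ▸ minpoly.monic halg
  rw [Polynomial.aeval_eq_sum_range, hdeg] at h
  simp only [Finset.sum_range_succ, Finset.sum_range_zero, hlead, Rat.smul_def] at h
  set p := (minpoly ℚ α).coeff 1
  set r := (minpoly ℚ α).coeff 0
  have hp : (p.den : ℂ) ≠ 0 := by exact_mod_cast p.den_nz
  have hr : (r.den : ℂ) ≠ 0 := by exact_mod_cast r.den_nz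
  refine ⟨p.den * r.den, p.num * r.den, r.num * p.den, by simp [p.den_nz, r.den_nz], ?_⟩
  rw [Rat.cast_def p, Rat.cast_def r] at h
  field_simp at h
  push_cast at h ⊢
  linear_combination h

lemma isIntegral_Wfun {N : ℕ} (hN1 : 1 < N) (hN : Odd N) {a₁ a₂ a₃ : ℤ} (h₁ : IsCoprime a₁ N)
    (h₂ : IsCoprime a₂ N) (h₃ : IsCoprime a₃ N) (hs₁ : IsCoprime (a₁ - a₃) N)
    (hp₁ : IsCoprime (a₁ + a₃) N) (hs₂ : IsCoprime (a₂ - a₃) N) (hp₂ : IsCoprime (a₂ + a₃) N)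
    {τ : ℍ} (hτ : IsIntegral ℤ (kleinJ τ)) : IsIntegral ℤ (Wfun N a₁ a₂ a₃ τ) := by
  have : NeZero N := ⟨by omega⟩
  have hN0 : (0 : ℤ) < N := by omega
  let F : Set (ℍ → ℂ) := torsionRatio N a₁ a₂ a₃ '' {c | ¬ ((N : ℤ) ∣ c.1 ∧ (N : ℤ) ∣ c.2)}
  have hF : F.Finite := by
    refine (((Set.finite_Icc (0 : ℤ) N).prod (Set.finite_Icc (0 : ℤ) N)).image
      (torsionRatio N a₁ a₂ a₃)).subset ?_
    rintro _ ⟨c, -, rfl⟩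
    exact ⟨(c.1 % N, c.2 % N), ⟨⟨Int.emod_nonneg _ hN0.ne', (Int.emod_lt_of_pos _ hN0).le⟩,
      ⟨Int.emod_nonneg _ hN0.ne', (Int.emod_lt_of_pos _ hN0).le⟩⟩, torsionRatio_eq_of_modEq
      ((Int.mod_modEq _ _).symm.dvd) ((Int.mod_modEq _ _).symm.dvd)⟩
  rw [Wfun_eq_torsionRatio]
  refine isIntegral_of_finite_stable (N := N) hF ?_ ?_ hτ ⟨(1, 0), ?_, rfl⟩
  · rintro _ ⟨c, hc, rfl⟩
    exact (exists_hasUnitExpansion_torsionRatio hN h₁ h₂ h₃ hs₁ hp₁ hs₂ hp₂ hc).elim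
      fun _ h ↦ h.mem
  · rintro _ ⟨c, hc, rfl⟩ γ
    refine ⟨_, fun ⟨h1, h2⟩ ↦ hc ?_, funext fun τ ↦ (torsionRatio_smul ..).symm⟩
    have hdet := γ.det_coe
    rw [Matrix.det_fin_two] at hdet
    constructor
    · refine ((h1.mul_right (γ 0 0)).sub (h2.mul_right (γ 0 1))).trans (dvd_of_eq ?_)
      linear_combination c.1 * hdet
    · refine ((h2.mul_right (γ 1 1)).sub (h1.mul_right (γ 1 0))).trans (dvd_of_eq ?_)
      linear_combination c.2 * hdet
  · rintro ⟨h, -⟩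
    exact absurd (Int.le_of_dvd one_pos h) (by omega)

end UpperHalfPlane

/-- for odd `N`, `𝔞 ∈ 𝔈₂` and an imaginary quadratic point `α` of the upper
half-plane, `W_𝔞(α)` is an algebraic unit. -/
theorem stmt16 (N : ℕ) (hN : 0 < N) (hodd : Odd N)
    (a : ℤ × ℤ × ℤ) (ha : memE2 N a) (α : ℂ) (hα : 0 < α.im)
    (halg : IsIntegral ℚ α) (hdeg : (minpoly ℚ α).natDegree = 2) :
    IsIntegral ℤ (Wfun N a.1 a.2.1 a.2.2 α) ∧
    IsIntegral ℤ (Wfun N a.1 a.2.1 a.2.2 α)⁻¹ := by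
  obtain ⟨⟨⟨hpos, -, -, hle, -⟩, hcop⟩, hs₁, hp₁, hs₂, hp₂⟩ := ha
  have hN1 : 1 < N := by omega
  have h₃ := hcop.of_mul_left_right
  have h₁ := hcop.of_mul_left_left.of_mul_left_left
  have h₂ := hcop.of_mul_left_left.of_mul_left_right
  obtain ⟨τ, rfl⟩ : ∃ τ : UpperHalfPlane, (τ : ℂ) = α := ⟨⟨α, hα⟩, rfl⟩
  obtain ⟨x, y, z, hx, hxyz⟩ := UpperHalfPlane.exists_int_quadratic halg hdeg
  have hj := UpperHalfPlane.isIntegral_kleinJ_of_quadratic hx hxyz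
  refine ⟨UpperHalfPlane.isIntegral_Wfun hN1 hodd h₁ h₂ h₃ hs₁ hp₁ hs₂ hp₂ hj, ?_⟩
  rw [Wfun, inv_div]
  exact UpperHalfPlane.isIntegral_Wfun hN1 hodd h₂ h₁ h₃ hs₂ hp₂ hs₁ hp₁ hj
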